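/- The spectrum of the length function on automorphisms, namely the set {L(Φ) : Φ ∈ Aut(F)}, is a discrete subset of ℝ: every point of ℝ has a neighborhood meeting this set in at most one point. -/

import Mathlib

open MeasureTheory Filter Topology
open scoped ENNReal NNReal

namespace FGC

noncomputable section

variable (k : ℕ)

/-- The alphabet `A = Σ ∪ Σ⁻¹`: a letter is a basis element together with a sign. -/
abbrev L := Fin k × Bool

/-- The inverse of a letter. -/
def linv (a : L k) : L k := (a.1, !a.2)

/-- A right-infinite word is (freely) reduced if no letter is followed by its inverse. -/
def Red (x : ℕ → L k) : Prop := ∀ n, x (n + 1) ≠ linv k (x n)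

/-- The boundary `∂F`: the set of infinite freely reduced words in the alphabet `A`. -/
def Boundary : Type := { x : ℕ → L k // Red k x }

instance : TopologicalSpace (Boundary k) :=
  inferInstanceAs (TopologicalSpace { x : ℕ → L k // Red k x })

instance : MeasurableSpace (Boundary k) := borel _

instance : BorelSpace (Boundary k) := ⟨rfl⟩

/-- The free group of rank `k`. -/
abbrev F := FreeGroup (Fin k)

/-- The word length `|v|` of an element of `F`. -/
def wordLength (v : F k) : ℕ := v.toWord.length

/-- The cyclically reduced length `‖v‖`: the minimal word length among conjugates of `v`. -/
def cyclLength (v : F k) : ℕ := sInf { n | ∃ g : F k, wordLength k (g * v * g⁻¹) = n }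

/-- The cylinder `Cyl v ⊆ ∂F` of rays starting with the reduced word of `v`. -/
def Cyl (v : F k) : Set (Boundary k) :=
  { x | ∀ i : Fin v.toWord.length, x.1 i = v.toWord.get i }

/-- The shift deleting the first letter of a ray. -/
def shift (x : ℕ → L k) : ℕ → L k := fun n => x (n + 1)

/-- Prepending a letter to a ray. -/
def cons (a : L k) (x : ℕ → L k) : ℕ → L k
  | 0 => a
  | n + 1 => x n

/-- Prepending a (reversed) finite word to a ray, performing free reduction. -/
def prependAux : List (L k) → (ℕ → L k) → ℕ → L k
  | [], x => x
  | a :: r, x => prependAux r (if x 0 = linv k a then shift k x else cons k a x)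

theorem red_shift {x : ℕ → L k} (hx : Red k x) : Red k (shift k x) :=
  fun n => hx (n + 1)

theorem red_cons {a : L k} {x : ℕ → L k} (hx : Red k x) (h : x 0 ≠ linv k a) :
    Red k (cons k a x) := by
  intro n
  cases n with
  | zero => exact h
  | succ m => exact hx m

theorem red_prependAux : ∀ (r : List (L k)) {x : ℕ → L k}, Red k x → Red k (prependAux k r x)
  | [], _, hx => hx
  | a :: r, x, hx => by
    by_cases h : x 0 = linv k a
    · simp only [prependAux, if_pos h]
      exact red_prependAux r (red_shift k hx)
    · simp only [prependAux, if_neg h]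
      exact red_prependAux r (red_cons k hx h)

/-- The left-translation action of `F` on `∂F`: concatenate and freely reduce. -/
def act (g : F k) (x : Boundary k) : Boundary k :=
  ⟨prependAux k g.toWord.reverse x.1, red_prependAux k _ x.2⟩

/-- The shift map `T : ∂F → ∂F`. -/
def Tmap (x : Boundary k) : Boundary k := ⟨shift k x.1, red_shift k x.2⟩

/-- The double boundary `∂²F`, as the complement of the diagonal. -/
def D2 : Set (Boundary k × Boundary k) := { p | p.1 ≠ p.2 }

/-- The diagonal action of `F` on `∂F × ∂F`. -/
def actPair (g : F k) (p : Boundary k × Boundary k) : Boundary k × Boundary k :=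
  (act k g p.1, act k g p.2)

/-- The cylinder `Cyl[1,w]` of geodesics through the segment from `1` to `w`. -/
def baseCyl (w : F k) : Set (Boundary k × Boundary k) :=
  { p | p.1.1 0 ≠ p.2.1 0 ∧ p.2 ∈ Cyl k w }

/-- The base-ball `B = Cyl[1,1]` of geodesics through the base point. -/
def baseBall : Set (Boundary k × Boundary k) := baseCyl k 1

/-- The cylinder `Cyl[x,y] = x · Cyl[1, x⁻¹y]`. -/
def Cyl2 (x y : F k) : Set (Boundary k × Boundary k) :=
  actPair k x '' baseCyl k (x⁻¹ * y)

/-- A geodesic current: a Borel measure on `∂F × ∂F` giving no mass to the diagonal,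
invariant under the diagonal `F`-action, and finite on compact subsets of `∂²F`. -/
def IsCurrent (η : Measure (Boundary k × Boundary k)) : Prop :=
  η { p | p.1 = p.2 } = 0 ∧
  (∀ g : F k, ∀ W : Set (Boundary k × Boundary k), MeasurableSet W →
    η (actPair k g ⁻¹' W) = η W) ∧
  (∀ K : Set (Boundary k × Boundary k), K ⊆ D2 k → IsCompact K → η K < ⊤)

/-- The element of `F` given by the first `n` letters of a ray. -/
def prefixEl (x : Boundary k) (n : ℕ) : F k :=
  FreeGroup.mk (List.ofFn fun i : Fin n => x.1 i)

/-- `b : ∂F → ∂F` is the boundary extension of the automorphism `Φ`: for every ray `x`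
and every `m`, the length-`m` prefix of `b x` is the length-`m` prefix of the reduced
word of `Φ (x|_n)` for all sufficiently large `n`. -/
def IsBdryExt (Φ : F k ≃* F k) (b : Boundary k → Boundary k) : Prop :=
  ∀ x : Boundary k, ∀ m : ℕ, ∃ N : ℕ, ∀ n ≥ N,
    (Φ (prefixEl k x n)).toWord.take m = List.ofFn fun i : Fin m => (b x).1 i

/-- The map `∂Φ × ∂Φ` on pairs. -/
def pairMap (b : Boundary k → Boundary k) (p : Boundary k × Boundary k) :
    Boundary k × Boundary k := (b p.1, b p.2)

/-- The length of an automorphism with boundary map `b`, w.r.t. the current `η`: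
`L(Φ) = η((∂Φ × ∂Φ)⁻¹ B)`. -/
def autLen (η : Measure (Boundary k × Boundary k)) (b : Boundary k → Boundary k) : ℝ≥0∞ :=
  η (pairMap k b ⁻¹' baseBall k)

/-- The subgroup of inner automorphisms. -/
abbrev Inn : Subgroup (MulAut (F k)) := (MulAut.conj : F k →* MulAut (F k)).range

/-- `Out(F) = Aut(F)/Inn(F)` as a coset space. -/
abbrev OutQ := MulAut (F k) ⧸ Inn k

/-- A simple automorphism: induced by a permutation of the basis, or inner. -/
def SimpleAut (Φ : MulAut (F k)) : Prop :=
  (∃ σ : Equiv.Perm (Fin k), ∀ i, Φ (FreeGroup.of i) = FreeGroup.of (σ i)) ∨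
  (∃ v : F k, ∀ x, Φ x = v * x * v⁻¹)

/-- A Whitehead automorphism of the second kind. -/
def Whitehead2 (τ : MulAut (F k)) : Prop :=
  ∃ a : Fin k, ∀ i : Fin k,
    τ (FreeGroup.of i) = FreeGroup.of i ∨
    τ (FreeGroup.of i) = FreeGroup.of i * FreeGroup.of a ∨
    τ (FreeGroup.of i) = (FreeGroup.of a)⁻¹ * FreeGroup.of i ∨
    τ (FreeGroup.of i) = (FreeGroup.of a)⁻¹ * FreeGroup.of i * FreeGroup.of a

/-- The space of frequency measures: finite `T`-invariant Borel measures on `∂F`. -/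
def FreqM : Type :=
  { μ : Measure (Boundary k) //
    IsFiniteMeasure μ ∧ ∀ W : Set (Boundary k), MeasurableSet W → μ (Tmap k ⁻¹' W) = μ W }

/-- The space of geodesic currents. -/
def Currents : Type := { η : Measure (Boundary k × Boundary k) // IsCurrent k η }

/-- Continuous functions on `∂F × ∂F` with compact support contained in `∂²F`;
these are the test functions for the weak-* topology on currents. -/
def TestF : Type :=
  { φ : Boundary k × Boundary k → ℝ //
    Continuous φ ∧ IsCompact (tsupport φ) ∧ tsupport φ ⊆ D2 k }

/-- The weak-* topology on frequency measures. -/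
instance : TopologicalSpace (FreqM k) :=
  ⨅ φ : C(Boundary k, ℝ),
    TopologicalSpace.induced (fun μ : FreqM k => ∫ x, φ x ∂μ.1) inferInstance

/-- The weak-* topology on geodesic currents. -/
instance : TopologicalSpace (Currents k) :=
  ⨅ φ : TestF k,
    TopologicalSpace.induced (fun η : Currents k => ∫ p, φ.1 p ∂η.1) inferInstance

/-- Convergence of a sequence of group elements (as reduced words) to a boundary ray. -/
def WordTendsto (pn : ℕ → F k) (p : Boundary k) : Prop :=
  ∀ m : ℕ, ∃ N : ℕ, ∀ n ≥ N, (pn n).toWord.take m = List.ofFn fun i : Fin m => p.1 i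

/-- The length of the maximal common initial segment of two rays. -/
def commonLen (p : Boundary k × Boundary k) : ℕ :=
  sSup { m : ℕ | ∀ i < m, p.1.1 i = p.2.1 i }

/-- A single letter as an element of `F`. -/
def el (a : L k) : F k := FreeGroup.mk [a]

/-- The product of per-letter constants over the reduced word of `w`. -/
def Cprod (C : L k → ℝ≥0) (w : F k) : ℝ≥0 := (w.toWord.map C).prod

section Proof

variable {k}

/-! ### The action on rays and its length cocycle -/

theorem Boundary.ext_letters {x y : Boundary k} (h : ∀ n, x.1 n = y.1 n) : x = y :=
  Subtype.ext (funext h)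

@[simp]
theorem linv_linv (a : L k) : linv k (linv k a) = a := by simp [linv]

/-- Prepending a letter to a ray when no cancellation occurs. -/
def bcons (a : L k) (x : Boundary k) (h : x.1 0 ≠ linv k a) : Boundary k :=
  ⟨cons k a x.1, red_cons k x.2 h⟩

/-- Left translation of a ray by a letter. -/
def letAct (a : L k) (x : Boundary k) : Boundary k :=
  if h : x.1 0 = linv k a then Tmap k x else bcons a x h

/-- The change of length of long prefixes of a ray under left translation by a letter. -/
def letCoc (a : L k) (x : Boundary k) : ℤ := if x.1 0 = linv k a then -1 else 1

theorem letAct_of_eq {a : L k} {x : Boundary k} (h : x.1 0 = linv k a) :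
    letAct a x = Tmap k x := dif_pos h

theorem letAct_of_ne {a : L k} {x : Boundary k} (h : x.1 0 ≠ linv k a) :
    letAct a x = bcons a x h := dif_neg h

theorem letAct_of_ne_zero {a : L k} {x : Boundary k} (h : x.1 0 ≠ linv k a) :
    (letAct a x).1 0 = a := by rw [letAct_of_ne h]; rfl

theorem letAct_of_ne_succ {a : L k} {x : Boundary k} (h : x.1 0 ≠ linv k a) (n : ℕ) :
    (letAct a x).1 (n + 1) = x.1 n := by rw [letAct_of_ne h]; rfl

theorem Tmap_letAct_of_ne {a : L k} {x : Boundary k} (h : x.1 0 ≠ linv k a) :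
    Tmap k (letAct a x) = x := by rw [letAct_of_ne h]; rfl

theorem Tmap_zero_ne (x : Boundary k) : (Tmap k x).1 0 ≠ linv k (x.1 0) := x.2 0

theorem letAct_zero_eq_iff {a : L k} {x : Boundary k} :
    (letAct a x).1 0 = a ↔ x.1 0 ≠ linv k a := by
  refine ⟨fun h h' => ?_, letAct_of_ne_zero⟩
  rw [letAct_of_eq h'] at h
  exact Tmap_zero_ne x (by rw [h, h', linv_linv])

theorem letAct_linv_letAct (a : L k) (x : Boundary k) : letAct (linv k a) (letAct a x) = x := by
  by_cases h : x.1 0 = linv k a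
  · have h' : (letAct a x).1 0 ≠ linv k (linv k a) := by
      rw [linv_linv]
      exact fun h2 => letAct_zero_eq_iff.1 h2 h
    rw [letAct_of_ne h']
    refine Boundary.ext_letters fun n => ?_
    cases n with
    | zero => exact h.symm
    | succ n =>
      change (letAct a x).1 n = _
      rw [letAct_of_eq h]
      rfl
  · rw [letAct_of_eq (by rw [linv_linv]; exact letAct_of_ne_zero h), Tmap_letAct_of_ne h]

theorem letCoc_linv_letAct (a : L k) (x : Boundary k) :
    letCoc (linv k a) (letAct a x) = - letCoc a x := by
  by_cases h : x.1 0 = linv k a <;> simp [letCoc, letAct_zero_eq_iff, h]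

/-- A letter acting on the skew product `∂F × ℤ`. -/
def stepEquiv (a : L k) : Equiv.Perm (Boundary k × ℤ) where
  toFun p := (letAct a p.1, p.2 + letCoc a p.1)
  invFun p := (letAct (linv k a) p.1, p.2 + letCoc (linv k a) p.1)
  left_inv p := by simp [letAct_linv_letAct, letCoc_linv_letAct]
  right_inv p := by
    have h1 := letAct_linv_letAct (linv k a) p.1
    have h2 := letCoc_linv_letAct (linv k a) p.1
    rw [linv_linv] at h1 h2
    simp [h1, h2]

/-- The action of `F` on the skew product `∂F × ℤ`. -/
def skew : F k →* Equiv.Perm (Boundary k × ℤ) := FreeGroup.lift fun i => stepEquiv (i, true)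

theorem skew_el (a : L k) : skew (el k a) = stepEquiv a := by
  obtain ⟨i, b⟩ := a
  cases b <;> simp only [skew, el, FreeGroup.lift_mk, List.map_cons, List.map_nil, List.prod_cons,
    List.prod_nil, mul_one, cond_true, cond_false]
  ext p <;> rfl

theorem mk_cons (a : L k) (l : List (L k)) :
    (FreeGroup.mk (a :: l) : F k) = el k a * FreeGroup.mk l := rfl

theorem el_inv (a : L k) : (el k a)⁻¹ = el k (linv k a) := rfl

@[elab_as_elim]
theorem el_induction {P : F k → Prop} (g : F k) (one : P 1)
    (mul : ∀ a h, P h → P (el k a * h)) : P g := by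
  rw [← FreeGroup.mk_toWord (x := g)]
  induction g.toWord with
  | nil => exact one
  | cons a l ih => rw [mk_cons]; exact mul a _ ih

theorem prependAux_append (l l' : List (L k)) (x : ℕ → L k) :
    prependAux k (l ++ l') x = prependAux k l' (prependAux k l x) := by
  induction l generalizing x with
  | nil => rfl
  | cons a l ih => exact ih _

theorem prependAux_reverse (l : List (L k)) (x : Boundary k) (n : ℤ) :
    prependAux k l.reverse x.1 = (skew (FreeGroup.mk l) (x, n)).1.1 := by
  induction l with
  | nil => rw [← FreeGroup.one_eq_mk, map_one]; rfl
  | cons a l ih =>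
    rw [List.reverse_cons, prependAux_append, ih, mk_cons, map_mul, skew_el]
    change _ = (letAct a (skew (FreeGroup.mk l) (x, n)).1).1
    generalize (skew (FreeGroup.mk l) (x, n)).1 = y
    by_cases h : y.1 0 = linv k a
    · rw [letAct_of_eq h]; simp [prependAux, h, Tmap]
    · rw [letAct_of_ne h]; simp [prependAux, h, bcons]

theorem act_eq_skew (g : F k) (x : Boundary k) (n : ℤ) : act k g x = (skew g (x, n)).1 := by
  refine Subtype.ext ?_
  change prependAux k g.toWord.reverse x.1 = _
  rw [prependAux_reverse _ _ n, FreeGroup.mk_toWord]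

/-- The change of length of long prefixes of a ray under left translation. -/
def coc (g : F k) (x : Boundary k) : ℤ := (skew g (x, 0)).2

theorem skew_snd (g : F k) (x : Boundary k) (n : ℤ) : (skew g (x, n)).2 = n + coc g x := by
  unfold coc
  induction g using el_induction generalizing n with
  | one => simp
  | mul a h ih =>
    have key : ∀ n, (skew (el k a * h) (x, n)).2 =
        n + ((skew h (x, 0)).2 + letCoc a (act k h x)) := fun n => by
      rw [map_mul, Equiv.Perm.mul_apply, skew_el, act_eq_skew h x n, ← add_assoc, ← ih n]
      rfl
    rw [key n, key 0, zero_add]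

theorem skew_apply (g : F k) (x : Boundary k) (n : ℤ) :
    skew g (x, n) = (act k g x, n + coc g x) :=
  Prod.ext (act_eq_skew g x n).symm (skew_snd g x n)

@[simp]
theorem act_one (x : Boundary k) : act k 1 x = x := by rw [act_eq_skew 1 x 0]; simp

@[simp]
theorem coc_one (x : Boundary k) : coc 1 x = 0 := by simp [coc]

theorem act_mul (g h : F k) (x : Boundary k) : act k (g * h) x = act k g (act k h x) := by
  rw [act_eq_skew (g * h) x 0, map_mul, Equiv.Perm.mul_apply, skew_apply, skew_apply]

theorem coc_mul (g h : F k) (x : Boundary k) :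
    coc (g * h) x = coc g (act k h x) + coc h x := by
  rw [coc, map_mul, Equiv.Perm.mul_apply, skew_apply, skew_apply]
  simp [add_comm]

@[simp]
theorem act_inv_act (g : F k) (x : Boundary k) : act k g⁻¹ (act k g x) = x := by
  rw [← act_mul, inv_mul_cancel, act_one]

@[simp]
theorem act_act_inv (g : F k) (x : Boundary k) : act k g (act k g⁻¹ x) = x := by
  rw [← act_mul, mul_inv_cancel, act_one]

theorem act_el (a : L k) (x : Boundary k) : act k (el k a) x = letAct a x := by
  rw [act_eq_skew _ x 0, skew_el]; rfl

theorem coc_el (a : L k) (x : Boundary k) : coc (el k a) x = letCoc a x := by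
  rw [coc, skew_el]; simp [stepEquiv]

theorem act_el_inv_of_eq {a : L k} {x : Boundary k} (h : x.1 0 = a) :
    act k (el k a)⁻¹ x = Tmap k x := by
  rw [el_inv, act_el, letAct_of_eq (by rw [linv_linv, h])]

theorem act_el_inv_zero_of_ne {a : L k} {x : Boundary k} (h : x.1 0 ≠ a) :
    (act k (el k a)⁻¹ x).1 0 = linv k a := by
  rw [el_inv, act_el, letAct_of_ne_zero (by rwa [linv_linv])]

theorem coc_el_inv (a : L k) (x : Boundary k) :
    coc (el k a)⁻¹ x = if x.1 0 = a then -1 else 1 := by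
  rw [el_inv, coc_el, letCoc, linv_linv]

theorem act_el_Tmap (x : Boundary k) : act k (el k (x.1 0)) (Tmap k x) = x := by
  rw [← act_el_inv_of_eq rfl, act_act_inv]

/-! ### Reduced words and prefixes of rays -/

theorem isReduced_cons_iff {a : L k} {l : List (L k)} :
    FreeGroup.IsReduced (a :: l) ↔ (∀ b ∈ l.head?, b ≠ linv k a) ∧ FreeGroup.IsReduced l := by
  unfold FreeGroup.IsReduced
  rw [List.isChain_cons]
  refine and_congr_left' (forall₂_congr fun b _ => ?_)
  obtain ⟨i, s⟩ := a
  obtain ⟨j, t⟩ := b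
  simp only [linv, ne_eq, Prod.mk.injEq, not_and]
  constructor
  · rintro h rfl h2
    have := h rfl
    subst this
    cases s <;> simp at h2
  · rintro h rfl
    have := h rfl
    cases s <;> cases t <;> simp_all

/-- The prefix of length `n` of a ray. -/
def pre (x : Boundary k) (n : ℕ) : List (L k) := List.ofFn fun i : Fin n => x.1 i

@[simp]
theorem length_pre (x : Boundary k) (n : ℕ) : (pre x n).length = n := by simp [pre]

@[simp]
theorem pre_zero (x : Boundary k) : pre x 0 = [] := by simp [pre]

theorem pre_succ (x : Boundary k) (n : ℕ) : pre x (n + 1) = x.1 0 :: pre (Tmap k x) n := by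
  simp only [pre, List.ofFn_succ]; rfl

theorem head?_pre {x : Boundary k} {n : ℕ} {b : L k} (h : b ∈ (pre x n).head?) : b = x.1 0 := by
  cases n with
  | zero => simp at h
  | succ n => rw [pre_succ] at h; simpa using h.symm

theorem isReduced_pre (x : Boundary k) (n : ℕ) : FreeGroup.IsReduced (pre x n) := by
  induction n generalizing x with
  | zero => simp
  | succ n ih =>
    rw [pre_succ, isReduced_cons_iff]
    exact ⟨fun b hb => by rw [head?_pre hb]; exact Tmap_zero_ne x, ih _⟩

theorem toWord_mk_of_isReduced {l : List (L k)} (h : FreeGroup.IsReduced l) :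
    (FreeGroup.mk l : F k).toWord = l := h.reduce_eq

theorem prefixEl_eq (x : Boundary k) (n : ℕ) : prefixEl k x n = FreeGroup.mk (pre x n) := rfl

theorem toWord_prefixEl (x : Boundary k) (n : ℕ) : (prefixEl k x n).toWord = pre x n :=
  toWord_mk_of_isReduced (isReduced_pre x n)

theorem prefixEl_succ (x : Boundary k) (n : ℕ) :
    prefixEl k x (n + 1) = el k (x.1 0) * prefixEl k (Tmap k x) n := by
  rw [prefixEl_eq, pre_succ, mk_cons]; rfl

@[simp]
theorem prefixEl_zero (x : Boundary k) : prefixEl k x 0 = 1 := by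
  rw [prefixEl_eq, pre_zero]; rfl

/-- The set of rays starting with the word `l`. -/
def LC (l : List (L k)) : Set (Boundary k) := { x | pre x l.length = l }

theorem Cyl_eq_LC (v : F k) : Cyl k v = LC v.toWord := by
  ext x
  simp only [Cyl, LC, Set.mem_ofPred_eq, pre]
  rw [List.ext_get_iff]
  simp only [List.length_ofFn, true_and, List.get_ofFn]
  exact ⟨fun h n h1 h2 => h ⟨n, h2⟩, fun h i => h i (by simp) i.2⟩

@[simp]
theorem LC_nil : LC ([] : List (L k)) = Set.univ := by ext x; simp [LC]

theorem mem_LC_cons {a : L k} {l : List (L k)} {x : Boundary k} :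
    x ∈ LC (a :: l) ↔ x.1 0 = a ∧ Tmap k x ∈ LC l := by
  simp only [LC, Set.mem_ofPred_eq, List.length_cons, pre_succ, List.cons.injEq]

theorem LC_zero_of_mem {a : L k} {l : List (L k)} {x : Boundary k} (h : x ∈ LC l)
    (ha : a ∈ l.head?) : x.1 0 = a := by
  cases l with
  | nil => simp at ha
  | cons b l => rw [(mem_LC_cons.1 h).1]; simpa using ha

theorem pre_mem_LC (x : Boundary k) (n : ℕ) : x ∈ LC (pre x n) := by simp [LC]

theorem LC_append_subset (l l' : List (L k)) : LC (l ++ l') ⊆ LC l := by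
  induction l with
  | nil => simp
  | cons a l ih =>
    intro x hx
    rw [List.cons_append, mem_LC_cons] at hx
    exact mem_LC_cons.2 ⟨hx.1, ih hx.2⟩

/-- A reduced word not cancelling with a ray is a prefix of the translated ray. -/
theorem act_mk_mem_LC {l : List (L k)} (hl : FreeGroup.IsReduced l) {x : Boundary k}
    (hx : ∀ c ∈ l.getLast?, x.1 0 ≠ linv k c) : act k (FreeGroup.mk l) x ∈ LC l := by
  induction l with
  | nil => simp
  | cons a l ih =>
    rw [isReduced_cons_iff] at hl
    have hne : (act k (FreeGroup.mk l) x).1 0 ≠ linv k a := by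
      cases l with
      | nil =>
        rw [← FreeGroup.one_eq_mk, act_one]
        exact hx a (by simp)
      | cons b l =>
        rw [LC_zero_of_mem (ih hl.2 (fun c hc => hx c (by simpa [List.getLast?_cons_cons] using hc)))
          (a := b) (by simp)]
        exact hl.1 b (by simp)
    rw [mk_cons, act_mul, act_el, mem_LC_cons, Tmap_letAct_of_ne hne]
    refine ⟨letAct_of_ne_zero hne, ?_⟩
    cases l with
    | nil => simp
    | cons b l =>
      exact ih hl.2 (fun c hc => hx c (by simpa [List.getLast?_cons_cons] using hc))

/-- The cocycle of the inverse of a word counts the prefixes of that word not shared by the ray,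
minus those that are shared. -/
theorem coc_mk_inv {l : List (L k)} (hl : FreeGroup.IsReduced l) (y : Boundary k) :
    coc (FreeGroup.mk l)⁻¹ y =
      ∑ i ∈ Finset.range l.length, (1 - 2 * (LC (l.take (i + 1))).indicator 1 y) := by
  induction l generalizing y with
  | nil => rw [← FreeGroup.one_eq_mk]; simp
  | cons a l ih =>
    rw [isReduced_cons_iff] at hl
    rw [mk_cons, mul_inv_rev, coc_mul, ih hl.2, coc_el_inv, List.length_cons,
      Finset.sum_range_succ']
    by_cases h : y.1 0 = a
    · rw [if_pos h, act_el_inv_of_eq h]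
      congr 1
      · refine Finset.sum_congr rfl fun i _ => ?_
        have h1 : y ∈ LC ((a :: l).take (i + 1 + 1)) ↔ Tmap k y ∈ LC (l.take (i + 1)) := by
          rw [List.take_succ_cons, mem_LC_cons]
          exact and_iff_right h
        by_cases h2 : Tmap k y ∈ LC (l.take (i + 1))
        · simp only [Set.indicator_of_mem h2, Set.indicator_of_mem (h1.2 h2)]; rfl
        · simp only [Set.indicator_of_notMem h2, Set.indicator_of_notMem (mt h1.1 h2)]
      · simp [Set.indicator, mem_LC_cons, h]
    · rw [if_neg h]
      congr 1
      · refine Finset.sum_congr rfl fun i hi => ?_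
        have h1 : y ∉ LC ((a :: l).take (i + 1 + 1)) := by simp [mem_LC_cons, h]
        have h2 : act k (el k a)⁻¹ y ∉ LC (l.take (i + 1)) := by
          cases l with
          | nil => simp at hi
          | cons b l =>
            simp only [List.take_succ_cons, mem_LC_cons, not_and]
            intro h3
            exact absurd (h3.symm.trans (act_el_inv_zero_of_ne h)) (hl.1 b (by simp))
        simp only [Set.indicator_of_notMem h1, Set.indicator_of_notMem h2]
      · simp [Set.indicator, mem_LC_cons, h]

/-! ### Word metric -/

theorem rel_iff {a b : L k} : (a.1 = b.1 → a.2 = b.2) ↔ b ≠ linv k a := by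
  have := isReduced_cons_iff (a := a) (l := [b])
  simpa [FreeGroup.IsReduced] using this

theorem isReduced_append_iff {l l' : List (L k)} :
    FreeGroup.IsReduced (l ++ l') ↔ FreeGroup.IsReduced l ∧ FreeGroup.IsReduced l' ∧
      ∀ a ∈ l.getLast?, ∀ b ∈ l'.head?, b ≠ linv k a := by
  unfold FreeGroup.IsReduced
  rw [List.isChain_append]
  simp only [rel_iff]

theorem mk_append (l l' : List (L k)) :
    (FreeGroup.mk (l ++ l') : F k) = FreeGroup.mk l * FreeGroup.mk l' := rfl

theorem isReduced_take {l : List (L k)} (h : FreeGroup.IsReduced l) (n : ℕ) :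
    FreeGroup.IsReduced (l.take n) := h.infix (List.take_prefix n l).isInfix

theorem norm_mk_of_isReduced {l : List (L k)} (h : FreeGroup.IsReduced l) :
    (FreeGroup.mk l : F k).norm = l.length := by
  rw [FreeGroup.norm, toWord_mk_of_isReduced h]

theorem norm_el (a : L k) : (el k a).norm = 1 := by
  rw [el, norm_mk_of_isReduced (by simp)]; rfl

theorem norm_prefixEl (x : Boundary k) (n : ℕ) : (prefixEl k x n).norm = n := by
  rw [FreeGroup.norm, toWord_prefixEl, length_pre]

theorem toWord_el_mul_of_eq {a : L k} {g : F k} {l : List (L k)}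
    (h : g.toWord = linv k a :: l) : (el k a * g).toWord = l := by
  have hr : FreeGroup.IsReduced (linv k a :: l) := h ▸ FreeGroup.isReduced_toWord
  rw [← FreeGroup.mk_toWord (x := g), h, mk_cons, ← el_inv, mul_inv_cancel_left,
    toWord_mk_of_isReduced (isReduced_cons_iff.1 hr).2]

theorem toWord_el_mul_of_ne {a : L k} {g : F k} (h : ∀ b ∈ g.toWord.head?, b ≠ linv k a) :
    (el k a * g).toWord = a :: g.toWord := by
  conv_lhs => rw [← FreeGroup.mk_toWord (x := g), ← mk_cons]
  exact toWord_mk_of_isReduced (isReduced_cons_iff.2 ⟨h, FreeGroup.isReduced_toWord⟩)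

theorem pre_take (x : Boundary k) {m n : ℕ} (h : m ≤ n) : (pre x n).take m = pre x m := by
  induction m generalizing x n with
  | zero => simp
  | succ m ih =>
    obtain ⟨n, rfl⟩ := Nat.exists_eq_succ_of_ne_zero (by omega : n ≠ 0)
    rw [Nat.succ_eq_add_one, pre_succ, pre_succ, List.take_succ_cons, ih _ (by omega)]

theorem take_toWord_mul_el (g : F k) (a : L k) {m : ℕ} (h : m < g.norm) :
    (g * el k a).toWord.take m = g.toWord.take m := by
  by_cases hr : FreeGroup.IsReduced (g.toWord ++ [a])
  · rw [show g * el k a = FreeGroup.mk (g.toWord ++ [a]) by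
      rw [mk_append, FreeGroup.mk_toWord]; rfl, toWord_mk_of_isReduced hr,
      List.take_append_of_le_length (le_of_lt h)]
  · rcases List.eq_nil_or_concat g.toWord with h0 | ⟨l, c, hl⟩
    · rw [FreeGroup.norm, h0] at h; simp at h
    · have hl' : g.toWord = l ++ [c] := by simpa using hl
      have hlr : FreeGroup.IsReduced (l ++ [c]) := hl' ▸ FreeGroup.isReduced_toWord
      rw [hl', isReduced_append_iff] at hr
      have hc : a = linv k c := by
        by_contra hne
        exact hr ⟨hlr, by simp, by simpa using hne⟩
      have hg : g * el k a = FreeGroup.mk l := by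
        rw [← FreeGroup.mk_toWord (x := g), hl', mk_append, hc, ← el_inv]
        exact mul_inv_cancel_right _ _
      rw [FreeGroup.norm, hl'] at h
      rw [hg, toWord_mk_of_isReduced (isReduced_append_iff.1 hlr).1, hl',
        List.take_append_of_le_length]
      simp at h
      omega

theorem exists_common_prefix {α : Type*} (l l' : List α) :
    ∃ r u v, l = r ++ u ∧ l' = r ++ v ∧ ∀ a ∈ u.head?, a ∉ v.head? := by
  induction l generalizing l' with
  | nil => exact ⟨[], [], l', by simp, by simp, by simp⟩
  | cons a l ih =>
    cases l' with
    | nil => exact ⟨[], a :: l, [], by simp, by simp, by simp⟩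
    | cons b l' =>
      by_cases h : a = b
      · obtain ⟨r, u, v, h1, h2, h3⟩ := ih l'
        exact ⟨a :: r, u, v, by simp [h1], by simp [h2, h], h3⟩
      · exact ⟨[], a :: l, b :: l', by simp, by simp, by simpa using fun h' => h h'.symm⟩

theorem isReduced_invRev {l : List (L k)} (h : FreeGroup.IsReduced l) :
    FreeGroup.IsReduced (FreeGroup.invRev l) := by
  rw [← toWord_mk_of_isReduced h, ← FreeGroup.toWord_inv]
  exact FreeGroup.isReduced_toWord

theorem getLast?_invRev {l : List (L k)} {a : L k} (h : a ∈ (FreeGroup.invRev l).getLast?) :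
    linv k a ∈ l.head? := by
  cases l with
  | nil => simp [FreeGroup.invRev] at h
  | cons b l =>
    simp only [FreeGroup.invRev, List.map_cons, List.reverse_cons, List.getLast?_append,
      List.getLast?_singleton, Option.some_or, Option.mem_some_iff] at h
    simp [← h, linv]

theorem toWord_inv_mul_of_diverge {u v : List (L k)} (hu : FreeGroup.IsReduced u)
    (hv : FreeGroup.IsReduced v) (h : ∀ a ∈ u.head?, a ∉ v.head?) :
    ((FreeGroup.mk u)⁻¹ * FreeGroup.mk v : F k).toWord = FreeGroup.invRev u ++ v := by
  rw [FreeGroup.inv_mk, FreeGroup.mul_mk]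
  refine toWord_mk_of_isReduced (isReduced_append_iff.2 ⟨isReduced_invRev hu, hv, ?_⟩)
  intro a ha b hb hab
  exact h _ (getLast?_invRev ha) (hab ▸ hb)

theorem norm_inv_mul_of_diverge {u v : List (L k)} (hu : FreeGroup.IsReduced u)
    (hv : FreeGroup.IsReduced v) (h : ∀ a ∈ u.head?, a ∉ v.head?) :
    ((FreeGroup.mk u)⁻¹ * FreeGroup.mk v : F k).norm = u.length + v.length := by
  rw [FreeGroup.norm, toWord_inv_mul_of_diverge hu hv h]
  simp [FreeGroup.invRev_length]

theorem mk_append_inv_mul (r u v : List (L k)) :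
    ((FreeGroup.mk (r ++ u))⁻¹ * FreeGroup.mk (r ++ v) : F k) =
      (FreeGroup.mk u)⁻¹ * FreeGroup.mk v := by
  rw [mk_append, mk_append]; group

/-- A path joining an element without prefix `p` to one with prefix `p` passes through `p`. -/
theorem norm_inv_mul_prefix_le {w w' : F k} {p : List (L k)}
    (hw : w.toWord.take p.length ≠ p) (hw' : w'.toWord.take p.length = p) :
    (w⁻¹ * FreeGroup.mk p).norm ≤ (w⁻¹ * w').norm := by
  obtain ⟨r, u, v, h1, h2, h3⟩ := exists_common_prefix w.toWord p
  have hs : w'.toWord = r ++ (v ++ w'.toWord.drop p.length) := by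
    conv_lhs => rw [← List.take_append_drop p.length w'.toWord, hw', h2]
    rw [List.append_assoc, h2]
  set s := w'.toWord.drop p.length
  have hu : FreeGroup.IsReduced u :=
    (isReduced_append_iff.1 (h1 ▸ FreeGroup.isReduced_toWord (x := w))).2.1
  have hvs : FreeGroup.IsReduced (v ++ s) :=
    (isReduced_append_iff.1 (hs ▸ FreeGroup.isReduced_toWord (x := w'))).2.1
  have hv := (isReduced_append_iff.1 hvs).1
  have hv0 : v ≠ [] := by
    rintro rfl
    apply hw
    rw [h1, h2]
    simp
  rw [← FreeGroup.mk_toWord (x := w), ← FreeGroup.mk_toWord (x := w'), h1, hs, h2,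
    mk_append_inv_mul, mk_append_inv_mul, norm_inv_mul_of_diverge hu hv h3,
    norm_inv_mul_of_diverge hu hvs, List.length_append]
  · omega
  · intro a ha hb
    refine h3 a ha ?_
    cases v with
    | nil => exact absurd rfl hv0
    | cons c v => simpa using hb

theorem exists_norm_map_le (Φ : F k →* F k) : ∃ C : ℕ, ∀ g, (Φ g).norm ≤ C * g.norm := by
  refine ⟨∑ a : L k, (Φ (el k a)).norm, fun g => ?_⟩
  have key : ∀ l : List (L k), (Φ (FreeGroup.mk l)).norm ≤
      (∑ a : L k, (Φ (el k a)).norm) * l.length := by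
    intro l
    induction l with
    | nil => rw [← FreeGroup.one_eq_mk]; simp
    | cons a l ih =>
      rw [mk_cons, map_mul]
      refine (FreeGroup.norm_mul_le _ _).trans ?_
      have := Finset.single_le_sum (f := fun a : L k => (Φ (el k a)).norm)
        (fun _ _ => Nat.zero_le _) (Finset.mem_univ a)
      rw [List.length_cons, mul_add, mul_one]
      omega
  have := key g.toWord
  rwa [FreeGroup.mk_toWord] at this

/-! ### The boundary extension of an automorphism -/

theorem WordTendsto.el_mul {w : ℕ → F k} {y : Boundary k} (h : WordTendsto k w y) (a : L k) :
    WordTendsto k (fun n => el k a * w n) (letAct a y) := by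
  intro m
  obtain ⟨N, hN⟩ := h (m + 1)
  refine ⟨N, fun n hn => ?_⟩
  change _ = pre (letAct a y) m
  have h1 : (w n).toWord.take (m + 1) = pre y (m + 1) := hN n hn
  rw [pre_succ] at h1
  by_cases hy : y.1 0 = linv k a
  · rw [letAct_of_eq hy]
    rcases hw : (w n).toWord with _ | ⟨c, l⟩
    · rw [hw] at h1; simp at h1
    · rw [hw, List.take_succ_cons, List.cons.injEq, hy] at h1
      rw [toWord_el_mul_of_eq (hw.trans (by rw [h1.1])), h1.2]
  · have hh : ∀ b ∈ (w n).toWord.head?, b ≠ linv k a := by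
      intro b hb
      rcases hw : (w n).toWord with _ | ⟨c, l⟩
      · rw [hw] at hb; simp at hb
      · rw [hw, List.take_succ_cons, List.cons.injEq] at h1
        rw [hw] at hb
        simp only [List.head?_cons, Option.mem_some_iff] at hb
        rw [← hb, h1.1]
        exact hy
    rw [toWord_el_mul_of_ne hh]
    cases m with
    | zero => simp
    | succ m =>
      rw [List.take_succ_cons, pre_succ, Tmap_letAct_of_ne hy, letAct_of_ne_zero hy,
        ← pre_take y (show m ≤ m + 1 + 1 by omega), pre_succ y, ← h1, List.take_take]
      congr 2
      omega

theorem WordTendsto.mul_left {w : ℕ → F k} {y : Boundary k} (h : WordTendsto k w y) (g : F k) :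
    WordTendsto k (fun n => g * w n) (act k g y) := by
  induction g using el_induction with
  | one => simpa using h
  | mul a g ih =>
    rw [act_mul, act_el]
    simpa only [mul_assoc] using ih.el_mul a

theorem WordTendsto.mul_el {w : ℕ → F k} {y : Boundary k} (h : WordTendsto k w y) (a : L k) :
    WordTendsto k (fun n => w n * el k a) y := by
  intro m
  obtain ⟨N, hN⟩ := h (m + 1)
  refine ⟨N, fun n hn => ?_⟩
  have h1 : (w n).toWord.take (m + 1) = pre y (m + 1) := hN n hn
  have h2 : m < (w n).norm := by
    have := congrArg List.length h1
    rw [List.length_take, length_pre] at this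
    rw [FreeGroup.norm]
    omega
  change _ = pre y m
  rw [take_toWord_mul_el _ _ h2, ← pre_take y (Nat.le_succ m), Nat.succ_eq_add_one, ← h1,
    List.take_take]
  congr 1
  omega

theorem WordTendsto.mul_right {w : ℕ → F k} {y : Boundary k} (h : WordTendsto k w y) (g : F k) :
    WordTendsto k (fun n => w n * g) y := by
  induction g using el_induction generalizing w with
  | one => simpa using h
  | mul a g ih =>
    simpa only [mul_assoc] using ih (h.mul_el a)

theorem WordTendsto.unique {w : ℕ → F k} {y y' : Boundary k} (h : WordTendsto k w y)
    (h' : WordTendsto k w y') : y = y' := by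
  refine Boundary.ext_letters fun n => ?_
  obtain ⟨N, hN⟩ := h (n + 1)
  obtain ⟨N', hN'⟩ := h' (n + 1)
  have := (hN (max N N') (le_max_left _ _)).symm.trans (hN' (max N N') (le_max_right _ _))
  rw [List.ofFn_inj] at this
  exact congrFun this (Fin.last n)

theorem WordTendsto.comp_succ {w : ℕ → F k} {y : Boundary k} (h : WordTendsto k w y) :
    WordTendsto k (fun n => w (n + 1)) y := by
  intro m
  obtain ⟨N, hN⟩ := h m
  exact ⟨N, fun n hn => hN (n + 1) (by omega)⟩

section BoundaryMap

variable {Φ : F k ≃* F k} {b : Boundary k → Boundary k}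

theorem IsBdryExt.wordTendsto (hb : IsBdryExt k Φ b) (x : Boundary k) :
    WordTendsto k (fun n => Φ (prefixEl k x n)) (b x) := hb x

theorem IsBdryExt.letAct (hb : IsBdryExt k Φ b) (a : L k) (x : Boundary k) :
    b (letAct a x) = act k (Φ (el k a)) (b x) := by
  have h1 := (hb.wordTendsto x).mul_left (Φ (el k a))
  have h2 := hb.wordTendsto (FGC.letAct a x)
  simp only [← map_mul] at h1
  by_cases h : x.1 0 = linv k a
  · refine h2.unique ?_
    convert h1.comp_succ using 3 with n
    rw [prefixEl_succ, h, ← el_inv, mul_inv_cancel_left, letAct_of_eq h]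
  · refine h2.comp_succ.unique ?_
    convert h1 using 3 with n
    rw [prefixEl_succ, Tmap_letAct_of_ne h, letAct_of_ne_zero h]

theorem IsBdryExt.act (hb : IsBdryExt k Φ b) (g : F k) (x : Boundary k) :
    b (act k g x) = act k (Φ g) (b x) := by
  induction g using el_induction with
  | one => simp
  | mul a g ih => rw [act_mul, act_el, hb.letAct, ih, map_mul, act_mul]

theorem norm_inv_prefixEl_mul {x x' : Boundary k} (h : x.1 0 ≠ x'.1 0) (m n : ℕ) :
    ((prefixEl k x m)⁻¹ * prefixEl k x' n).norm = m + n := by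
  rw [prefixEl_eq, prefixEl_eq, norm_inv_mul_of_diverge (isReduced_pre _ _) (isReduced_pre _ _),
    length_pre, length_pre]
  intro a ha ha'
  exact h ((head?_pre ha).symm.trans (head?_pre ha'))

theorem prefixEl_succ' (x : Boundary k) (n : ℕ) :
    prefixEl k x (n + 1) = prefixEl k x n * el k (x.1 n) := by
  rw [prefixEl_eq, prefixEl_eq, el, FreeGroup.mul_mk]
  simp only [pre, List.ofFn_succ']
  simp

theorem IsBdryExt.exists_near (hb : IsBdryExt k Φ b) {C : ℕ}
    (hC : ∀ g, (Φ g).norm ≤ C * g.norm) (x : Boundary k) (n : ℕ) :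
    ∃ j, ((Φ (prefixEl k x j))⁻¹ * prefixEl k (b x) n).norm ≤ C := by
  classical
  have hex : ∃ N, ∀ j ≥ N, (Φ (prefixEl k x j)).toWord.take n = pre (b x) n := hb x n
  rcases Nat.eq_zero_or_pos (Nat.find hex) with h0 | hpos
  · have h1 := Nat.find_spec hex 0 (by omega)
    refine ⟨0, ?_⟩
    rw [prefixEl_eq (b x), ← h1]
    simp [← FreeGroup.one_eq_mk]
  · obtain ⟨j, hj⟩ := Nat.exists_eq_succ_of_ne_zero hpos.ne'
    have h1 : (Φ (prefixEl k x j)).toWord.take n ≠ pre (b x) n := by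
      intro h
      refine Nat.find_min hex (m := j) (by omega) fun i hi => ?_
      rcases hi.eq_or_lt with rfl | hi
      · exact h
      · exact Nat.find_spec hex i (by omega)
    have h2 := Nat.find_spec hex (j + 1) (by omega)
    refine ⟨j, ?_⟩
    have := norm_inv_mul_prefix_le (p := pre (b x) n) (by simpa using h1) (by simpa using h2)
    refine this.trans ?_
    rw [prefixEl_succ', map_mul, inv_mul_cancel_left]
    simpa [norm_el] using hC (el k (x.1 j))

theorem IsBdryExt.ne_of_zero_ne (hb : IsBdryExt k Φ b) {x x' : Boundary k}
    (h : x.1 0 ≠ x'.1 0) : b x ≠ b x' := by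
  intro hxx
  obtain ⟨C, hC⟩ := exists_norm_map_le (Φ : F k →* F k)
  obtain ⟨C', hC'⟩ := exists_norm_map_le (Φ.symm : F k →* F k)
  simp only [MonoidHom.coe_coe] at hC hC'
  set n := C + C * (C' * (2 * C)) + 1 with hn
  obtain ⟨j, hj⟩ := hb.exists_near hC x n
  obtain ⟨j', hj'⟩ := hb.exists_near hC x' n
  rw [← hxx] at hj'
  set y := prefixEl k (b x) n with hy
  have h1 : j + j' ≤ C' * (2 * C) := by
    rw [← norm_inv_prefixEl_mul h j j']
    have h2 := hC' (Φ ((prefixEl k x j)⁻¹ * prefixEl k x' j'))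
    rw [MulEquiv.symm_apply_apply] at h2
    refine h2.trans (Nat.mul_le_mul_left _ ?_)
    rw [map_mul, map_inv]
    have h3 : (Φ (prefixEl k x j))⁻¹ * Φ (prefixEl k x' j') =
      ((Φ (prefixEl k x j))⁻¹ * y) * ((Φ (prefixEl k x' j'))⁻¹ * y)⁻¹ := by group
    rw [h3]
    refine (FreeGroup.norm_mul_le _ _).trans ?_
    rw [FreeGroup.norm_inv_eq]
    omega
  have h4 : n ≤ C * j + C := by
    rw [← norm_prefixEl (b x) n, ← hy]
    have h5 : y = Φ (prefixEl k x j) * ((Φ (prefixEl k x j))⁻¹ * y) := by group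
    rw [h5]
    refine (FreeGroup.norm_mul_le _ _).trans (add_le_add ?_ hj)
    simpa [norm_prefixEl] using hC (prefixEl k x j)
  have h6 : C * j ≤ C * (C' * (2 * C)) := Nat.mul_le_mul_left _ (by omega)
  omega

theorem IsBdryExt.injective (hb : IsBdryExt k Φ b) : Function.Injective b := by
  intro x x' hxx
  refine Boundary.ext_letters fun n => ?_
  induction n generalizing x x' with
  | zero =>
    by_contra h
    exact hb.ne_of_zero_ne h hxx
  | succ n ih =>
    have h0 : x.1 0 = x'.1 0 := by
      by_contra h
      exact hb.ne_of_zero_ne h hxx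
    refine @ih (Tmap k x) (Tmap k x') ?_
    rw [← act_el_inv_of_eq rfl, ← act_el_inv_of_eq h0.symm, hb.act, hb.act, hxx]

theorem IsBdryExt.conj (hb : IsBdryExt k Φ b) {Ψ : F k ≃* F k} {b' : Boundary k → Boundary k}
    (hb' : IsBdryExt k Ψ b') (p : F k) (h : ∀ g, Ψ g = p * Φ g * p⁻¹) (x : Boundary k) :
    b' x = FGC.act k p (b x) := by
  refine (hb'.wordTendsto x).unique ?_
  simp only [h]
  exact ((hb.wordTendsto x).mul_left p).mul_right p⁻¹

end BoundaryMap

/-! ### Measurability on the boundary -/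

theorem measurable_iff_letters {α : Type*} [MeasurableSpace α] {f : α → Boundary k} :
    Measurable f ↔ ∀ n a, MeasurableSet {y | (f y).1 n = a} := by
  have h : (inferInstance : MeasurableSpace (Boundary k)) =
      (Subtype.instMeasurableSpace : MeasurableSpace { x : ℕ → L k // Red k x }) :=
    (BorelSpace.measurable_eq (α := { x : ℕ → L k // Red k x })).symm
  have h1 : Measurable f ↔ Measurable fun y => (f y).1 := by
    have : Measurable f ↔
        @Measurable α { x : ℕ → L k // Red k x } _ Subtype.instMeasurableSpace f := by rw [← h]; exact Iff.rfl
    rw [this]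
    exact ⟨fun hf => measurable_subtype_coe.comp hf, fun hf => hf.subtype_mk⟩
  rw [h1, measurable_pi_iff]
  refine forall_congr' fun n => ⟨fun hf a => hf (measurableSet_singleton a), fun hf => ?_⟩
  exact measurable_to_countable' hf

theorem measurableSet_letter (n : ℕ) (a : L k) : MeasurableSet {x : Boundary k | x.1 n = a} :=
  measurable_iff_letters.1 measurable_id n a

theorem measurable_Tmap : Measurable (Tmap k) :=
  measurable_iff_letters.2 fun n a => measurableSet_letter (n + 1) a

theorem measurableSet_LC (l : List (L k)) : MeasurableSet (LC l) := by
  induction l with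
  | nil => simp
  | cons a l ih =>
    have : LC (a :: l) = {x : Boundary k | x.1 0 = a} ∩ Tmap k ⁻¹' LC l := by
      ext x; exact mem_LC_cons
    rw [this]
    exact (measurableSet_letter 0 a).inter (measurable_Tmap ih)

theorem LC_subset_of_inter {l l' : List (L k)} (hle : l.length ≤ l'.length)
    (h : (LC l ∩ LC l').Nonempty) : LC l' ⊆ LC l := by
  obtain ⟨x, hx, hx'⟩ := h
  have : l = l'.take l.length := by
    conv_lhs => rw [← (hx : pre x l.length = l)]
    rw [← pre_take x hle, (hx' : pre x l'.length = l')]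
  rw [this]
  conv_lhs => rw [← List.take_append_drop l.length l']
  exact LC_append_subset _ _

theorem isPiSystem_LC : IsPiSystem (Set.range (LC (k := k))) := by
  rintro _ ⟨l, rfl⟩ _ ⟨l', rfl⟩ h
  rcases le_total l.length l'.length with hle | hle
  · exact ⟨l', by rw [Set.inter_eq_right.2 (LC_subset_of_inter hle h)]⟩
  · exact ⟨l, by rw [Set.inter_eq_left.2 (LC_subset_of_inter hle (Set.inter_comm _ _ ▸ h))]⟩

theorem mem_LC_iff_pre {l : List (L k)} {x : Boundary k} : x ∈ LC l ↔ pre x l.length = l := Iff.rfl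

theorem getLast?_pre (x : Boundary k) (n : ℕ) : (pre x (n + 1)).getLast? = some (x.1 n) := by
  simp only [pre, List.ofFn_succ']
  simp

theorem borel_eq_generateFrom_LC :
    (inferInstance : MeasurableSpace (Boundary k)) =
      MeasurableSpace.generateFrom (Set.range (LC (k := k))) := by
  refine le_antisymm ?_ ?_
  · have : @Measurable (Boundary k) (Boundary k)
        (MeasurableSpace.generateFrom (Set.range (LC (k := k)))) _ id := by
      refine (@measurable_iff_letters k (Boundary k) (MeasurableSpace.generateFrom _) id).2 ?_
      intro n a
      have hU : {y : Boundary k | (id y).1 n = a} =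
          ⋃ l ∈ {l : List (L k) | l.length = n + 1 ∧ l.getLast? = some a}, LC l := by
        ext x
        simp only [id, Set.mem_iUnion, Set.mem_ofPred_eq, exists_prop]
        constructor
        · intro h
          exact ⟨pre x (n + 1), ⟨length_pre _ _, by rw [getLast?_pre, h]⟩, pre_mem_LC _ _⟩
        · rintro ⟨l, ⟨h1, h2⟩, h3⟩
          rw [mem_LC_iff_pre, h1] at h3
          rw [← h3, getLast?_pre] at h2
          simpa using h2
      rw [hU]
      exact MeasurableSet.biUnion (Set.to_countable _)
        fun l _ => MeasurableSpace.measurableSet_generateFrom ⟨l, rfl⟩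
    exact fun s hs => this hs
  · refine MeasurableSpace.generateFrom_le ?_
    rintro _ ⟨l, rfl⟩
    exact measurableSet_LC l

theorem LC_eq_empty {l : List (L k)} (h : ¬ FreeGroup.IsReduced l) : LC l = ∅ := by
  refine Set.eq_empty_of_forall_notMem fun x hx => h ?_
  rw [← (hx : pre x l.length = l)]
  exact isReduced_pre _ _

theorem LC_singleton (a : L k) : LC [a] = {x : Boundary k | x.1 0 = a} := by
  ext x; simp [mem_LC_cons]

theorem measure_eq_sum_letters (m : Measure (Boundary k)) (s : Set (Boundary k)) :
    m s = ∑ a : L k, m ({x | x.1 0 = a} ∩ s) := by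
  have h : Measurable fun x : Boundary k => x.1 0 :=
    measurable_to_countable' fun a => measurableSet_letter 0 a
  have hs := sum_measure_preimage_singleton (μ := m.restrict s) Finset.univ
    (f := fun x : Boundary k => x.1 0) fun a _ => measurableSet_letter 0 a
  rw [Finset.coe_univ, Set.preimage_univ, Measure.restrict_apply_univ] at hs
  rw [← hs]
  exact Finset.sum_congr rfl fun a _ => Measure.restrict_apply (measurableSet_letter 0 a)

/-- Finite measures on the boundary are determined by their values on proper cylinders. -/
theorem measure_ext_LC {m m' : Measure (Boundary k)} [IsFiniteMeasure m]
    (h : ∀ l : List (L k), FreeGroup.IsReduced l → l ≠ [] → m (LC l) = m' (LC l)) : m = m' := by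
  have huniv : m Set.univ = m' Set.univ := by
    rw [measure_eq_sum_letters m, measure_eq_sum_letters m']
    refine Finset.sum_congr rfl fun a _ => ?_
    rw [Set.inter_univ, ← LC_singleton]
    exact h [a] (by simp) (by simp)
  refine ext_of_generate_finite _ borel_eq_generateFrom_LC isPiSystem_LC ?_ huniv
  rintro _ ⟨l, rfl⟩
  by_cases hl : FreeGroup.IsReduced l
  · by_cases h0 : l = []
    · rw [h0, LC_nil, huniv]
    · exact h l hl h0
  · rw [LC_eq_empty hl]; simp

theorem measurable_letAct (a : L k) : Measurable (letAct a) := by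
  refine measurable_iff_letters.2 fun n c => ?_
  have h0 := measurableSet_letter (k := k) 0 (linv k a)
  cases n with
  | zero =>
    have : {y | (letAct a y).1 0 = c} =
        ({y | y.1 0 = linv k a} ∩ {y | y.1 1 = c}) ∪ ({y | y.1 0 = linv k a}ᶜ ∩ {_y | a = c}) := by
      ext y
      by_cases h : y.1 0 = linv k a
      · simp [letAct_of_eq h, h, Tmap, shift]
      · simp [letAct_of_ne_zero h, h]
    rw [this]
    exact (h0.inter (measurableSet_letter 1 c)).union (h0.compl.inter (MeasurableSet.const _))
  | succ n =>
    have : {y | (letAct a y).1 (n + 1) = c} =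
        ({y | y.1 0 = linv k a} ∩ {y | y.1 (n + 2) = c}) ∪
          ({y | y.1 0 = linv k a}ᶜ ∩ {y | y.1 n = c}) := by
      ext y
      by_cases h : y.1 0 = linv k a
      · simp [letAct_of_eq h, h, Tmap, shift]
      · simp [letAct_of_ne_succ h, h]
    rw [this]
    exact (h0.inter (measurableSet_letter _ c)).union (h0.compl.inter (measurableSet_letter _ c))

theorem measurable_act (g : F k) : Measurable (act k g) := by
  induction g using el_induction with
  | one => simpa [show act k (1 : F k) = id from funext act_one] using measurable_id
  | mul a g ih =>
    rw [show act k (el k a * g) = letAct a ∘ act k g from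
      funext fun x => by rw [act_mul, act_el]; rfl]
    exact (measurable_letAct a).comp ih

theorem measurable_coc (g : F k) : Measurable (coc g) := by
  induction g using el_induction with
  | one => simp [show coc (1 : F k) = fun _ => 0 from funext coc_one]
  | mul a g ih =>
    rw [show coc (el k a * g) = fun x => letCoc a (act k g x) + coc g x from
      funext fun x => by rw [coc_mul, coc_el]]
    refine Measurable.add (Measurable.comp (g := letCoc a) ?_ (measurable_act g)) ih
    exact Measurable.ite (measurableSet_letter 0 _) measurable_const measurable_const

theorem abs_coc_le (g : F k) (x : Boundary k) : |coc g x| ≤ g.norm := by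
  have key : ∀ l : List (L k), |coc (FreeGroup.mk l) x| ≤ l.length := by
    intro l
    induction l with
    | nil => rw [← FreeGroup.one_eq_mk]; simp
    | cons a l ih =>
      rw [mk_cons, coc_mul, coc_el, List.length_cons]
      refine (abs_add_le _ _).trans ?_
      have : |letCoc a (act k (FreeGroup.mk l) x)| ≤ 1 := by
        unfold letCoc; split <;> simp
      push_cast
      linarith
  have := key g.toWord
  rwa [FreeGroup.mk_toWord] at this

theorem IsBdryExt.measurable {Φ : F k ≃* F k} {b : Boundary k → Boundary k}
    (hb : IsBdryExt k Φ b) : Measurable b := by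
  refine measurable_iff_letters.2 fun n a => ?_
  have hU : {x | (b x).1 n = a} = ⋃ N, ⋂ j ≥ N,
      {x | ((Φ (prefixEl k x j)).toWord.take (n + 1)).getLast? = some a} := by
    ext x
    simp only [Set.mem_iUnion, Set.mem_iInter, Set.mem_ofPred_eq]
    obtain ⟨N, hN⟩ := hb x (n + 1)
    constructor
    · intro h
      refine ⟨N, fun j hj => ?_⟩
      rw [hN j hj, ← h]
      exact getLast?_pre (b x) n
    · rintro ⟨M, hM⟩
      have h1 := hM (max N M) (le_max_right _ _)
      rw [hN _ (le_max_left _ _)] at h1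
      exact Option.some_injective _ ((getLast?_pre (b x) n).symm.trans h1)
  rw [hU]
  refine MeasurableSet.iUnion fun N => MeasurableSet.iInter fun j => MeasurableSet.iInter fun _ => ?_
  have : {x | ((Φ (prefixEl k x j)).toWord.take (n + 1)).getLast? = some a} =
      ⋃ l ∈ {l : List (L k) | l.length = j ∧
        ((Φ (FreeGroup.mk l)).toWord.take (n + 1)).getLast? = some a}, LC l := by
    ext x
    simp only [Set.mem_iUnion, Set.mem_ofPred_eq, exists_prop]
    constructor
    · intro h
      exact ⟨pre x j, ⟨length_pre _ _, h⟩, pre_mem_LC _ _⟩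
    · rintro ⟨l, ⟨h1, h2⟩, h3⟩
      rw [mem_LC_iff_pre, h1] at h3
      rwa [prefixEl_eq, h3]
  rw [this]
  exact MeasurableSet.biUnion (Set.to_countable _) fun l _ => measurableSet_LC l

/-! ### The uniform measure -/

/-- The uniform frequency measure, specified on cylinders over reduced words. -/
structure IsUniform (μ : Measure (Boundary k)) : Prop where
  prob : IsProbabilityMeasure μ
  two_le : 2 ≤ k
  apply_LC : ∀ l : List (L k), FreeGroup.IsReduced l → l ≠ [] →
    μ (LC l) = ((2 * k : ℝ≥0∞))⁻¹ * ((2 * k - 1 : ℝ≥0∞)⁻¹) ^ (l.length - 1)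

namespace IsUniform

variable {μ : Measure (Boundary k)}

theorem of_cyl [IsProbabilityMeasure μ] (hk : 2 ≤ k)
    (h : ∀ v : F k, v ≠ 1 →
      μ (Cyl k v) = ((2 * k : ℝ≥0∞) * (2 * k - 1) ^ (wordLength k v - 1))⁻¹) :
    IsUniform μ := by
  refine ⟨inferInstance, hk, fun l hl h0 => ?_⟩
  have h1 := h (FreeGroup.mk l) (by
    intro h2
    have := congrArg FreeGroup.toWord h2
    rw [toWord_mk_of_isReduced hl, FreeGroup.toWord_one] at this
    exact h0 this)
  rw [Cyl_eq_LC, wordLength, toWord_mk_of_isReduced hl] at h1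
  rw [h1, ENNReal.mul_inv, ENNReal.inv_pow]
  · left; norm_cast; omega
  · left; exact ENNReal.mul_ne_top (by simp) (by simp)


theorem const_eq : (2 * k - 1 : ℝ≥0∞) = ((2 * k - 1 : ℕ) : ℝ≥0∞) := by
  rw [ENNReal.natCast_sub]; push_cast; rfl

theorem const_mul_inv (hk : 2 ≤ k) : (2 * k - 1 : ℝ≥0∞) * (2 * k - 1 : ℝ≥0∞)⁻¹ = 1 := by
  rw [const_eq]
  exact ENNReal.mul_inv_cancel (by norm_cast; omega) (ENNReal.natCast_ne_top _)

theorem const_add_one (hk : 2 ≤ k) : (2 * k - 1 : ℝ≥0∞) + 1 = 2 * k := by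
  rw [const_eq]; norm_cast; omega

theorem const_toReal (hk : 2 ≤ k) : (2 * k - 1 : ℝ≥0∞).toReal = 2 * k - 1 := by
  rw [const_eq, ENNReal.toReal_natCast, Nat.cast_sub (by omega)]; push_cast; rfl

theorem apply_letter (hμ : IsUniform μ) (a : L k) : μ {x | x.1 0 = a} = ((2 * k : ℝ≥0∞))⁻¹ := by
  rw [← LC_singleton, hμ.apply_LC [a] (by simp) (by simp)]; simp

theorem apply_letter_compl (hμ : IsUniform μ) (a : L k) :
    μ {x | x.1 0 = a}ᶜ = (2 * k - 1 : ℝ≥0∞) * ((2 * k : ℝ≥0∞))⁻¹ := by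
  have := hμ.prob
  rw [prob_compl_eq_one_sub (measurableSet_letter 0 a), hμ.apply_letter]
  symm
  refine ENNReal.eq_sub_of_add_eq ?_ ?_
  · have := hμ.two_le; simp; omega
  · nth_rewrite 2 [← one_mul (2 * k : ℝ≥0∞)⁻¹]
    rw [← add_mul, const_add_one hμ.two_le]
    refine ENNReal.mul_inv_cancel ?_ ?_
    · have := hμ.two_le; norm_cast; omega
    · exact ENNReal.mul_ne_top (by simp) (by simp)

/-- Left translation by a letter rescales the uniform measure. -/
theorem map_letAct (hμ : IsUniform μ) (a : L k) :
    μ.map (letAct a) = (2 * k - 1 : ℝ≥0∞) • μ.restrict {x | x.1 0 = a} +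
      (2 * k - 1 : ℝ≥0∞)⁻¹ • μ.restrict {x | x.1 0 = a}ᶜ := by
  have := hμ.prob
  have : IsFiniteMeasure (μ.map (letAct a)) := inferInstance
  refine measure_ext_LC fun l hl h0 => ?_
  have hc := const_mul_inv hμ.two_le
  rw [Measure.map_apply (measurable_letAct a) (measurableSet_LC l)]
  simp only [Measure.coe_add, Measure.coe_smul, Pi.add_apply, Pi.smul_apply, smul_eq_mul,
    Measure.restrict_apply (measurableSet_LC l)]
  rcases l with _ | ⟨d, l⟩
  · exact absurd rfl h0
  by_cases hd : d = a
  · subst hd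
    have h1 : LC (d :: l) ∩ {x | x.1 0 = d} = LC (d :: l) :=
      Set.inter_eq_left.2 fun x hx => (mem_LC_cons.1 hx).1
    have h2 : LC (d :: l) ∩ {x | x.1 0 = d}ᶜ = ∅ :=
      Set.eq_empty_of_forall_notMem fun x hx => hx.2 (mem_LC_cons.1 hx.1).1
    have h3 : letAct d ⁻¹' LC (d :: l) = {x | x.1 0 = linv k d}ᶜ ∩ LC l := by
      ext x
      rw [Set.mem_preimage, mem_LC_cons, letAct_zero_eq_iff]
      exact and_congr_right fun h => by rw [Tmap_letAct_of_ne h]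
    rw [h1, h2, h3, measure_empty, mul_zero, add_zero, hμ.apply_LC _ hl h0]
    rcases l with _ | ⟨e, l⟩
    · simp [hμ.apply_letter_compl]
    · have h4 : {x : Boundary k | x.1 0 = linv k d}ᶜ ∩ LC (e :: l) = LC (e :: l) := by
        refine Set.inter_eq_right.2 fun x hx => ?_
        rw [Set.mem_compl_iff, Set.mem_ofPred_eq, (mem_LC_cons.1 hx).1]
        exact (isReduced_cons_iff.1 hl).1 e (by simp)
      rw [h4, hμ.apply_LC _ (isReduced_cons_iff.1 hl).2 (by simp)]
      simp only [List.length_cons, Nat.add_sub_cancel, pow_succ]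
      rw [show (2 * k - 1 : ℝ≥0∞) * ((2 * k : ℝ≥0∞)⁻¹ * ((2 * k - 1 : ℝ≥0∞)⁻¹ ^ l.length *
        (2 * k - 1 : ℝ≥0∞)⁻¹)) = ((2 * k - 1 : ℝ≥0∞) * (2 * k - 1 : ℝ≥0∞)⁻¹) *
        ((2 * k : ℝ≥0∞)⁻¹ * (2 * k - 1 : ℝ≥0∞)⁻¹ ^ l.length) by ring, hc, one_mul]
  · have h1 : LC (d :: l) ∩ {x | x.1 0 = a} = ∅ :=
      Set.eq_empty_of_forall_notMem fun x hx =>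
        hd ((mem_LC_cons.1 hx.1).1.symm.trans hx.2)
    have h2 : LC (d :: l) ∩ {x | x.1 0 = a}ᶜ = LC (d :: l) :=
      Set.inter_eq_left.2 fun x hx h => hd ((mem_LC_cons.1 hx).1.symm.trans h)
    have h3 : letAct a ⁻¹' LC (d :: l) = LC (linv k a :: d :: l) := by
      ext x
      rw [Set.mem_preimage, mem_LC_cons (a := linv k a)]
      by_cases h : x.1 0 = linv k a
      · rw [letAct_of_eq h]; simp [h]
      · simp only [h, false_and, iff_false]
        intro h'
        exact hd ((mem_LC_cons.1 h').1.symm.trans (letAct_of_ne_zero h))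
    rw [h1, h2, h3, measure_empty, mul_zero, zero_add, hμ.apply_LC _ hl h0, hμ.apply_LC]
    · simp only [List.length_cons, Nat.add_sub_cancel, pow_succ]
      ring
    · exact isReduced_cons_iff.2 ⟨by simpa using hd, hl⟩
    · simp

theorem integral_letAct (hμ : IsUniform μ) (a : L k) {φ : Boundary k → ℝ}
    (hφ : Measurable φ) {K : ℝ} (hK : ∀ x, |φ x| ≤ K) :
    ∫ x, φ (letAct a x) ∂μ = (2 * k - 1) * ∫ x in {x | x.1 0 = a}, φ x ∂μ +
      (2 * k - 1 : ℝ)⁻¹ * ∫ x in {x | x.1 0 = a}ᶜ, φ x ∂μ := by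
  have := hμ.prob
  have hi : ∀ m : Measure (Boundary k), IsFiniteMeasure m → Integrable φ m := fun m _ =>
    Integrable.of_bound hφ.aestronglyMeasurable K (ae_of_all _ hK)
  have hc : (2 * k - 1 : ℝ≥0∞) ≠ ⊤ := by rw [const_eq]; exact ENNReal.natCast_ne_top _
  have hc' : (2 * k - 1 : ℝ≥0∞)⁻¹ ≠ ⊤ := by
    rw [const_eq, ENNReal.inv_ne_top]; have := hμ.two_le; norm_cast; omega
  rw [← integral_map (φ := letAct a) (measurable_letAct a).aemeasurable
    hφ.aestronglyMeasurable, hμ.map_letAct, integral_add_measure, integral_smul_measure,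
    integral_smul_measure, ENNReal.toReal_inv, const_toReal hμ.two_le, smul_eq_mul, smul_eq_mul]
  · exact (hi _ inferInstance).smul_measure hc
  · exact (hi _ inferInstance).smul_measure hc'

theorem integral_eq_sum (hμ : IsUniform μ) {φ : Boundary k → ℝ}
    (hφ : Measurable φ) {K : ℝ} (hK : ∀ x, |φ x| ≤ K) :
    ∫ x, φ x ∂μ = ∑ a : L k, ∫ x in {x | x.1 0 = a}, φ x ∂μ := by
  have := hμ.prob
  have hi : Integrable φ μ := Integrable.of_bound hφ.aestronglyMeasurable K (ae_of_all _ hK)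
  rw [← integral_iUnion_fintype (fun a => measurableSet_letter 0 a)]
  · rw [show (⋃ a : L k, {x : Boundary k | x.1 0 = a}) = Set.univ by ext; simp,
      Measure.restrict_univ]
  · intro a b hab
    exact Set.disjoint_left.2 fun x hx hx' => hab (hx.symm.trans hx')
  · exact fun a => hi.integrableOn

/-- The uniform measure is stationary for the simple random walk. -/
theorem sum_integral_letAct (hμ : IsUniform μ) {φ : Boundary k → ℝ}
    (hφ : Measurable φ) {K : ℝ} (hK : ∀ x, |φ x| ≤ K) :
    ∑ a : L k, ∫ x, φ (letAct a x) ∂μ = 2 * k * ∫ x, φ x ∂μ := by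
  have := hμ.prob
  have hi : Integrable φ μ := Integrable.of_bound hφ.aestronglyMeasurable K (ae_of_all _ hK)
  have hc : (2 * k - 1 : ℝ) ≠ 0 := by
    have : (2 : ℝ) ≤ k := by exact_mod_cast hμ.two_le
    linarith
  have h1 : ∀ a : L k, ∫ x, φ (letAct a x) ∂μ = (2 * k - 1 - (2 * k - 1 : ℝ)⁻¹) *
      (∫ x in {x | x.1 0 = a}, φ x ∂μ) + (2 * k - 1 : ℝ)⁻¹ * ∫ x, φ x ∂μ := fun a => by
    rw [hμ.integral_letAct a hφ hK, ← integral_add_compl (measurableSet_letter 0 a) hi]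
    ring
  simp only [h1]
  rw [Finset.sum_add_distrib, ← Finset.mul_sum, ← hμ.integral_eq_sum hφ hK]
  simp only [Finset.sum_const, Finset.card_univ, Fintype.card_prod, Fintype.card_fin,
    Fintype.card_bool, nsmul_eq_mul]
  push_cast
  field_simp
  ring

theorem setIntegral_letAct_linv (hμ : IsUniform μ) (a : L k) {φ : Boundary k → ℝ}
    (hφ : Measurable φ) {K : ℝ} (hK : ∀ x, |φ x| ≤ K) :
    ∫ x in {x | x.1 0 = a}, φ (letAct (linv k a) x) ∂μ =
      (2 * k - 1 : ℝ)⁻¹ * ∫ x in {x | x.1 0 = linv k a}ᶜ, φ x ∂μ := by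
  set s : Set (Boundary k) := {x | x.1 0 = linv k a}ᶜ with hs
  have hsm : MeasurableSet s := (measurableSet_letter 0 _).compl
  have h1 := hμ.integral_letAct (linv k a) (hφ.indicator hsm) (K := K) fun x => by
    by_cases hx : x ∈ s
    · rw [Set.indicator_of_mem hx]; exact hK x
    · rw [Set.indicator_of_notMem hx, abs_zero]; exact (abs_nonneg _).trans (hK x)
  rw [← hs, setIntegral_indicator hsm, setIntegral_indicator hsm, hs, Set.inter_compl_self,
    Set.inter_self] at h1
  rw [← integral_indicator (measurableSet_letter 0 a)]
  simp only [Measure.restrict_empty, integral_zero_measure, mul_zero, zero_add] at h1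
  rw [← h1]
  congr 1
  ext x
  have h2 := letAct_zero_eq_iff (a := linv k a) (x := x)
  rw [linv_linv] at h2
  by_cases hx : x.1 0 = a
  · rw [Set.indicator_of_mem (by exact hx), Set.indicator_of_mem]
    exact fun h3 => h2.1 h3 hx
  · rw [Set.indicator_of_notMem (by exact hx), Set.indicator_of_notMem]
    exact fun h3 => h3 (h2.2 hx)

theorem setIntegral_compl_letAct_linv (hμ : IsUniform μ) (a : L k) {φ : Boundary k → ℝ}
    (hφ : Measurable φ) {K : ℝ} (hK : ∀ x, |φ x| ≤ K) :
    ∫ x in {x | x.1 0 = a}ᶜ, φ (letAct (linv k a) x) ∂μ =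
      (2 * k - 1 : ℝ) * ∫ x in {x | x.1 0 = linv k a}, φ x ∂μ := by
  have := hμ.prob
  have hi : Integrable (fun x => φ (letAct (linv k a) x)) μ :=
    Integrable.of_bound (hφ.comp (measurable_letAct _)).aestronglyMeasurable K
      (ae_of_all _ fun x => hK _)
  have h1 := integral_add_compl (measurableSet_letter 0 a) hi
  rw [hμ.integral_letAct _ hφ hK, hμ.setIntegral_letAct_linv a hφ hK] at h1
  linarith

/-- The uniform measure is shift invariant. -/
theorem integral_Tmap (hμ : IsUniform μ) {φ : Boundary k → ℝ}
    (hφ : Measurable φ) {K : ℝ} (hK : ∀ x, |φ x| ≤ K) :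
    ∫ x, φ (Tmap k x) ∂μ = ∫ x, φ x ∂μ := by
  have := hμ.prob
  have hi : Integrable φ μ := Integrable.of_bound hφ.aestronglyMeasurable K (ae_of_all _ hK)
  have hc : (2 * k - 1 : ℝ) ≠ 0 := by
    have : (2 : ℝ) ≤ k := by exact_mod_cast hμ.two_le
    linarith
  rw [hμ.integral_eq_sum (φ := fun x => φ (Tmap k x)) (hφ.comp measurable_Tmap) (K := K)
    (fun x => hK _)]
  have h1 : ∀ a : L k, ∫ x in {x | x.1 0 = a}, φ (Tmap k x) ∂μ =
      (2 * k - 1 : ℝ)⁻¹ * ((∫ x, φ x ∂μ) - ∫ x in {x | x.1 0 = linv k a}, φ x ∂μ) := fun a => by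
    rw [← integral_add_compl (measurableSet_letter 0 (linv k a)) hi, add_sub_cancel_left,
      ← hμ.setIntegral_letAct_linv a hφ hK]
    refine setIntegral_congr_fun (measurableSet_letter 0 a) fun x hx => ?_
    rw [letAct_of_eq]
    rw [linv_linv]; exact hx
  simp only [h1]
  rw [← Finset.mul_sum, Finset.sum_sub_distrib]
  have h2 : ∑ a : L k, ∫ x in {x | x.1 0 = linv k a}, φ x ∂μ = ∫ x, φ x ∂μ := by
    rw [hμ.integral_eq_sum hφ hK]
    exact Fintype.sum_equiv ⟨linv k, linv k, linv_linv, linv_linv⟩ _ _ fun a => rfl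
  rw [h2]
  simp only [Finset.sum_const, Finset.card_univ, Fintype.card_prod, Fintype.card_fin,
    Fintype.card_bool, nsmul_eq_mul]
  push_cast
  field_simp

theorem singleton_eq_zero (hμ : IsUniform μ) (x : Boundary k) : μ {x} = 0 := by
  have hc : (2 * k - 1 : ℝ≥0∞)⁻¹ < 1 := by
    rw [const_eq, ENNReal.inv_lt_one]
    have := hμ.two_le; norm_cast; omega
  have h1 : Tendsto (fun n : ℕ => ((2 * k : ℝ≥0∞))⁻¹ * ((2 * k - 1 : ℝ≥0∞)⁻¹) ^ n) atTop (𝓝 0) := by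
    have h2 := ENNReal.Tendsto.const_mul (a := (2 * k : ℝ≥0∞)⁻¹)
      (ENNReal.tendsto_pow_atTop_nhds_zero_of_lt_one hc) (Or.inr ?_)
    · simpa using h2
    · have := hμ.two_le; simp; omega
  refine le_antisymm (ge_of_tendsto' h1 fun n => ?_) zero_le
  have h3 := hμ.apply_LC (pre x (n + 1)) (isReduced_pre _ _) (by simp [pre_succ])
  rw [length_pre, Nat.add_sub_cancel] at h3
  rw [← h3]
  exact measure_mono (Set.singleton_subset_iff.2 (pre_mem_LC _ _))

end IsUniform

/-! ### Averaged displacement of an automorphism -/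

section Displacement

variable {Φ : F k ≃* F k} {b : Boundary k → Boundary k} {μ : Measure (Boundary k)}

/-- The length cocycle of `Φ g` at the image of a ray under the boundary map. -/
def bcoc (Φ : F k ≃* F k) (b : Boundary k → Boundary k) (g : F k) (x : Boundary k) : ℤ :=
  coc (Φ g) (b x)

/-- The average over `x` of the Busemann function of `b x` at `Φ g`. -/
def disp (μ : Measure (Boundary k)) (Φ : F k ≃* F k) (b : Boundary k → Boundary k) (g : F k) : ℝ :=
  ∫ x, (bcoc Φ b g⁻¹ x : ℝ) ∂μ

/-- The advance of the image of a ray under one step of the ray. -/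
def stepGain (Φ : F k ≃* F k) (b : Boundary k → Boundary k) (x : Boundary k) : ℤ :=
  - bcoc Φ b (el k (x.1 0))⁻¹ x

theorem bcoc_one (x : Boundary k) : bcoc Φ b 1 x = 0 := by simp [bcoc]

theorem bcoc_mul (hb : IsBdryExt k Φ b) (g h : F k) (x : Boundary k) :
    bcoc Φ b (g * h) x = bcoc Φ b g (act k h x) + bcoc Φ b h x := by
  simp only [bcoc]
  rw [map_mul, coc_mul, hb.act]

theorem bcoc_inv (hb : IsBdryExt k Φ b) (g : F k) (x : Boundary k) :
    bcoc Φ b g⁻¹ x = - bcoc Φ b g (act k g⁻¹ x) := by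
  have := bcoc_mul hb g g⁻¹ x
  rw [mul_inv_cancel, bcoc_one] at this
  linarith

theorem measurable_bcoc (hb : IsBdryExt k Φ b) (g : F k) : Measurable (bcoc Φ b g) :=
  (measurable_coc _).comp hb.measurable

theorem measurable_bcoc_real (hb : IsBdryExt k Φ b) (g : F k) :
    Measurable fun x => (bcoc Φ b g x : ℝ) :=
  (Measurable.of_discrete (f := fun n : ℤ => (n : ℝ))).comp (measurable_bcoc hb g)

theorem abs_bcoc_le (g : F k) (x : Boundary k) : |(bcoc Φ b g x : ℝ)| ≤ (Φ g).norm := by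
  exact_mod_cast abs_coc_le (Φ g) (b x)

theorem integrable_bcoc [IsFiniteMeasure μ] (hb : IsBdryExt k Φ b) (g : F k) :
    Integrable (fun x => (bcoc Φ b g x : ℝ)) μ :=
  Integrable.of_bound (measurable_bcoc_real hb g).aestronglyMeasurable _
    (ae_of_all _ fun x => abs_bcoc_le g x)

theorem disp_one : disp μ Φ b 1 = 0 := by simp [disp, bcoc_one]

theorem sum_linv {M : Type*} [AddCommMonoid M] (f : L k → M) : ∑ a, f (linv k a) = ∑ a, f a :=
  Fintype.sum_equiv ⟨linv k, linv k, linv_linv, linv_linv⟩ _ _ fun _ => rfl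

theorem sum_disp_mul (hμ : IsUniform μ) (hb : IsBdryExt k Φ b) (g : F k) :
    ∑ a, disp μ Φ b (el k a * g) = ∑ a, disp μ Φ b (el k a) + 2 * k * disp μ Φ b g := by
  have := hμ.prob
  have h1 : ∀ a : L k, disp μ Φ b (el k a * g) =
      (∫ x, (bcoc Φ b g⁻¹ (letAct (linv k a) x) : ℝ) ∂μ) + disp μ Φ b (el k a) := fun a => by
    rw [disp, disp, ← integral_add _ (integrable_bcoc hb _)]
    · congr 1
      ext x
      rw [mul_inv_rev, bcoc_mul hb, el_inv, act_el]
      push_cast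
      rfl
    · exact Integrable.of_bound
        ((measurable_bcoc_real hb _).comp (measurable_letAct _)).aestronglyMeasurable _
        (ae_of_all _ fun x => abs_bcoc_le g⁻¹ _)
  simp only [h1]
  rw [Finset.sum_add_distrib, add_comm,
    sum_linv fun a => ∫ x, (bcoc Φ b g⁻¹ (letAct a x) : ℝ) ∂μ,
    hμ.sum_integral_letAct (measurable_bcoc_real hb _) (abs_bcoc_le _)]
  rfl

theorem measurable_stepGain (hb : IsBdryExt k Φ b) : Measurable (stepGain Φ b) := by
  refine measurable_to_countable' fun n => ?_
  have : stepGain Φ b ⁻¹' {n} =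
      ⋃ a : L k, {x | x.1 0 = a} ∩ bcoc Φ b (el k a)⁻¹ ⁻¹' {-n} := by
    ext x
    simp only [stepGain, Set.mem_preimage, Set.mem_singleton_iff, Set.mem_iUnion, Set.mem_inter_iff,
      Set.mem_ofPred_eq, exists_eq_left']
    omega
  rw [this]
  exact MeasurableSet.iUnion fun a => (measurableSet_letter 0 a).inter
    (measurable_bcoc hb _ (measurableSet_singleton _))

theorem exists_stepGain_le (Φ : F k ≃* F k) (b : Boundary k → Boundary k) :
    ∃ K : ℕ, ∀ x, |stepGain Φ b x| ≤ K := by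
  obtain ⟨C, hC⟩ := exists_norm_map_le (Φ : F k →* F k)
  refine ⟨C, fun x => ?_⟩
  rw [stepGain, abs_neg]
  refine (abs_coc_le _ _).trans ?_
  have := hC (el k (x.1 0))⁻¹
  rw [FreeGroup.norm_inv_eq, norm_el, mul_one] at this
  exact_mod_cast this

theorem sum_disp_el (hμ : IsUniform μ) (hb : IsBdryExt k Φ b) :
    ∑ a, disp μ Φ b (el k a) = (2 * k - 2) * ∫ x, (stepGain Φ b x : ℝ) ∂μ := by
  have := hμ.prob
  set J : L k → ℝ := fun a => ∫ x in {x | x.1 0 = a}, (bcoc Φ b (el k a)⁻¹ x : ℝ) ∂μ with hJ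
  have h1 : ∀ a, disp μ Φ b (el k a) = J a - (2 * k - 1) * J (linv k a) := fun a => by
    rw [disp, ← integral_add_compl (measurableSet_letter 0 a) (integrable_bcoc hb _), hJ,
      sub_eq_add_neg]
    congr 1
    simp only
    rw [← el_inv, inv_inv, ← hμ.setIntegral_compl_letAct_linv a (measurable_bcoc_real hb _)
      (abs_bcoc_le _), ← integral_neg]
    congr 1
    ext x
    rw [bcoc_inv hb, el_inv, act_el]
    push_cast
    rfl
  obtain ⟨K, hK⟩ := exists_stepGain_le Φ b
  have h2 : ∫ x, (stepGain Φ b x : ℝ) ∂μ = - ∑ a, J a := by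
    rw [hμ.integral_eq_sum (φ := fun x => (stepGain Φ b x : ℝ)) (K := K)
      ((Measurable.of_discrete (f := fun n : ℤ => (n : ℝ))).comp (measurable_stepGain hb))
      (fun x => by exact_mod_cast hK x), ← Finset.sum_neg_distrib]
    refine Finset.sum_congr rfl fun a _ => ?_
    rw [hJ, ← integral_neg]
    refine setIntegral_congr_fun (measurableSet_letter 0 a) fun x hx => ?_
    simp only [Set.mem_ofPred_eq] at hx
    simp [stepGain, hx]
  rw [h2]
  simp only [h1]
  rw [Finset.sum_sub_distrib, ← Finset.mul_sum, sum_linv]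
  ring

theorem disp_eq_sum [IsProbabilityMeasure μ] (hb : IsBdryExt k Φ b) (g : F k) :
    disp μ Φ b g = ∑ i ∈ Finset.range (Φ g).norm,
      (1 - 2 * μ.real (b ⁻¹' LC ((Φ g).toWord.take (i + 1)))) := by
  have h1 : ∀ x, (bcoc Φ b g⁻¹ x : ℝ) = ∑ i ∈ Finset.range (Φ g).norm,
      (1 - 2 * (b ⁻¹' LC ((Φ g).toWord.take (i + 1))).indicator (1 : Boundary k → ℝ) x) := by
    intro x
    have h2 := coc_mk_inv (FreeGroup.isReduced_toWord (x := Φ g)) (b x)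
    rw [FreeGroup.mk_toWord, ← map_inv] at h2
    rw [bcoc, h2]
    push_cast
    refine Finset.sum_congr rfl fun i _ => ?_
    congr 2
    by_cases h : b x ∈ LC ((Φ g).toWord.take (i + 1))
    · rw [Set.indicator_of_mem h, Set.indicator_of_mem (by exact h)]; simp
    · rw [Set.indicator_of_notMem h, Set.indicator_of_notMem (by exact h)]; simp
  rw [disp]
  simp only [h1]
  have hm : ∀ i, MeasurableSet (b ⁻¹' LC ((Φ g).toWord.take (i + 1))) := fun i =>
    hb.measurable (measurableSet_LC _)
  have hi : ∀ i, Integrable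
      ((b ⁻¹' LC ((Φ g).toWord.take (i + 1))).indicator (1 : Boundary k → ℝ)) μ :=
    fun i => (integrable_const (1 : ℝ)).indicator (hm i)
  have hi' : ∀ i, Integrable (fun x =>
      1 - 2 * (b ⁻¹' LC ((Φ g).toWord.take (i + 1))).indicator (1 : Boundary k → ℝ) x) μ :=
    fun i => (integrable_const _).sub ((hi i).const_mul _)
  rw [integral_finsetSum _ fun i _ => hi' i]
  refine Finset.sum_congr rfl fun i _ => ?_
  rw [integral_sub (integrable_const _) ((hi i).const_mul _), integral_const_mul,
    integral_indicator_one (hm i)]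
  simp

theorem real_LC_take_le [IsProbabilityMeasure μ]
    (hhalf : ∀ a, μ.real (b ⁻¹' LC [a]) ≤ 1 / 2) {l : List (L k)} (hl : l ≠ []) :
    μ.real (b ⁻¹' LC l) ≤ 1 / 2 := by
  rcases l with _ | ⟨a, l⟩
  · exact absurd rfl hl
  · exact (measureReal_mono (Set.preimage_mono (LC_append_subset [a] l))).trans (hhalf a)

theorem disp_nonneg [IsProbabilityMeasure μ] (hb : IsBdryExt k Φ b)
    (hhalf : ∀ a, μ.real (b ⁻¹' LC [a]) ≤ 1 / 2) (g : F k) : 0 ≤ disp μ Φ b g := by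
  rw [disp_eq_sum hb]
  refine Finset.sum_nonneg fun i hi => ?_
  have := real_LC_take_le hhalf (l := (Φ g).toWord.take (i + 1)) (by
    rw [Finset.mem_range, FreeGroup.norm] at hi
    intro h
    have := congrArg List.length h
    simp at this
    simp [this] at hi)
  linarith

/-- The constant bounding the displacement on the ball of radius `n`. -/
def growthConst (k : ℕ) : ℕ → ℝ
  | 0 => 0
  | n + 1 => 1 + 2 * k * growthConst k n

theorem growthConst_nonneg (n : ℕ) : 0 ≤ growthConst k n := by
  induction n with
  | zero => simp [growthConst]
  | succ n ih => simp only [growthConst]; positivity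

theorem growthConst_mono (hk : 1 ≤ k) : Monotone (growthConst k) := by
  refine monotone_nat_of_le_succ fun n => ?_
  have h1 := growthConst_nonneg (k := k) n
  have h2 : (1 : ℝ) ≤ k := by exact_mod_cast hk
  simp only [growthConst]
  nlinarith

theorem disp_le (hμ : IsUniform μ) (hb : IsBdryExt k Φ b)
    (hhalf : ∀ a, μ.real (b ⁻¹' LC [a]) ≤ 1 / 2) {n : ℕ} {g : F k} (hg : g.norm ≤ n) :
    disp μ Φ b g ≤ growthConst k n * ∑ a, disp μ Φ b (el k a) := by
  have := hμ.prob
  have hn := disp_nonneg hb hhalf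
  have key : ∀ l : List (L k), disp μ Φ b (FreeGroup.mk l) ≤
      growthConst k l.length * ∑ a, disp μ Φ b (el k a) := by
    intro l
    induction l with
    | nil => rw [← FreeGroup.one_eq_mk, disp_one]; simp [growthConst]
    | cons a l ih =>
      have h1 := Finset.single_le_sum (f := fun a => disp μ Φ b (el k a * FreeGroup.mk l))
        (fun _ _ => hn _) (Finset.mem_univ a)
      rw [sum_disp_mul hμ hb] at h1
      rw [mk_cons]
      refine h1.trans ?_
      simp only [List.length_cons, growthConst]
      have h2 : (0 : ℝ) ≤ 2 * k := by positivity
      nlinarith [mul_le_mul_of_nonneg_left ih h2]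
  have h1 := key g.toWord
  rw [FreeGroup.mk_toWord] at h1
  refine h1.trans (mul_le_mul_of_nonneg_right ?_ (Finset.sum_nonneg fun _ _ => hn _))
  exact growthConst_mono (by have := hμ.two_le; omega) hg

end Displacement

/-! ### The mean step gain is a lower bound for the length -/

section LengthBound

variable {Φ : F k ≃* F k} {b : Boundary k → Boundary k} {μ : Measure (Boundary k)}

/-- The advance of the image of a ray after `j` steps of the ray. -/
def gain (Φ : F k ≃* F k) (b : Boundary k → Boundary k) (j : ℕ) (x : Boundary k) : ℤ :=
  - bcoc Φ b (prefixEl k x j)⁻¹ x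

theorem gain_zero (x : Boundary k) : gain Φ b 0 x = 0 := by simp [gain, bcoc_one]

theorem gain_succ (hb : IsBdryExt k Φ b) (j : ℕ) (x : Boundary k) :
    gain Φ b (j + 1) x = stepGain Φ b x + gain Φ b j (Tmap k x) := by
  rw [gain, prefixEl_succ, mul_inv_rev, bcoc_mul hb, act_el_inv_of_eq rfl, gain, stepGain]
  ring

theorem measurable_gain (hb : IsBdryExt k Φ b) (j : ℕ) : Measurable (gain Φ b j) := by
  induction j with
  | zero => simp [show gain Φ b 0 = fun _ => 0 from funext gain_zero]
  | succ j ih =>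
    rw [show gain Φ b (j + 1) = fun x => stepGain Φ b x + gain Φ b j (Tmap k x) from
      funext (gain_succ hb j)]
    exact (measurable_stepGain hb).add (ih.comp measurable_Tmap)

/-- The minimal gain over the first `n + 1` positive times. -/
def minGain (Φ : F k ≃* F k) (b : Boundary k → Boundary k) : ℕ → Boundary k → ℤ
  | 0, x => stepGain Φ b x
  | n + 1, x => stepGain Φ b x + min 0 (minGain Φ b n (Tmap k x))

theorem minGain_le_gain (hb : IsBdryExt k Φ b) {j n : ℕ} (h : j ≤ n) (x : Boundary k) :
    minGain Φ b n x ≤ gain Φ b (j + 1) x := by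
  induction n generalizing j x with
  | zero =>
    obtain rfl : j = 0 := by omega
    rw [gain_succ hb, gain_zero, minGain, add_zero]
  | succ n ih =>
    rw [gain_succ hb, minGain]
    rcases j with _ | j
    · rw [gain_zero]
      exact add_le_add_right (min_le_left _ _) _
    · exact add_le_add_right ((min_le_right _ _).trans (ih (by omega) _)) _

theorem minGain_succ_le (n : ℕ) (x : Boundary k) :
    minGain Φ b (n + 1) x ≤ minGain Φ b n x := by
  induction n generalizing x with
  | zero => simp [minGain]
  | succ n ih =>
    rw [minGain, minGain]
    exact add_le_add_right (min_le_min_left _ (ih _)) _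

theorem measurable_minGain (hb : IsBdryExt k Φ b) (n : ℕ) : Measurable (minGain Φ b n) := by
  induction n with
  | zero => exact measurable_stepGain hb
  | succ n ih =>
    exact (measurable_stepGain hb).add (measurable_const.min (ih.comp measurable_Tmap))

theorem minGain_le {K : ℕ} (hK : ∀ x, |stepGain Φ b x| ≤ K) (n : ℕ) (x : Boundary k) :
    minGain Φ b n x ≤ K := by
  have h := (abs_le.1 (hK x)).2
  cases n with
  | zero => exact h
  | succ n =>
    rw [minGain]
    have := min_le_left 0 (minGain Φ b n (Tmap k x))
    linarith

theorem abs_minGain_le {K : ℕ} (hK : ∀ x, |stepGain Φ b x| ≤ K) (n : ℕ) (x : Boundary k) :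
    |minGain Φ b n x| ≤ (n + 1) * K := by
  induction n generalizing x with
  | zero => simpa [minGain] using hK x
  | succ n ih =>
    rw [minGain]
    refine (abs_add_le _ _).trans ?_
    have h1 : |min 0 (minGain Φ b n (Tmap k x))| ≤ (n + 1) * K := by
      rcases min_choice 0 (minGain Φ b n (Tmap k x)) with h | h <;> rw [h]
      · simp
      · exact ih _
    have := hK x
    push_cast
    linarith

theorem integral_stepGain_le_posPart (hμ : IsUniform μ) (hb : IsBdryExt k Φ b) (n : ℕ) :
    ∫ x, (stepGain Φ b x : ℝ) ∂μ ≤ ∫ x, ((max 0 (minGain Φ b n x) : ℤ) : ℝ) ∂μ := by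
  have := hμ.prob
  obtain ⟨K, hK⟩ := exists_stepGain_le Φ b
  have hcast : Measurable fun n : ℤ => (n : ℝ) := Measurable.of_discrete
  have hint : ∀ f : Boundary k → ℤ, Measurable f → ∀ C : ℤ, (∀ x, |f x| ≤ C) →
      Integrable (fun x => (f x : ℝ)) μ := fun f hf C hC =>
    Integrable.of_bound (hcast.comp hf).aestronglyMeasurable C
      (ae_of_all _ fun x => by
        rw [Real.norm_eq_abs]; exact_mod_cast hC x)
  have hW := measurable_minGain hb n
  have hWb := abs_minGain_le hK n
  have hmb : ∀ x, |min 0 (minGain Φ b n x)| ≤ (n + 1) * K := fun x => by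
    rcases min_choice 0 (minGain Φ b n x) with h | h <;> rw [h]
    · simp
    · exact hWb _
  have hMb : ∀ x, |max 0 (minGain Φ b n x)| ≤ (n + 1) * K := fun x => by
    rcases max_choice 0 (minGain Φ b n x) with h | h <;> rw [h]
    · simp
    · exact hWb _
  have i1 := hint _ (measurable_stepGain hb) K hK
  have i2 := hint _ (measurable_const.min hW) _ hmb
  have i3 := hint _ (measurable_const.max hW) _ hMb
  have i4 := hint _ (measurable_minGain hb (n + 1)) _ (abs_minGain_le hK (n + 1))
  have i5 := hint _ hW _ hWb
  have i6 := hint (fun x => min 0 (minGain Φ b n (Tmap k x)))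
    (measurable_const.min (hW.comp measurable_Tmap)) _ fun x => hmb _
  have hT := hμ.integral_Tmap (φ := fun x => ((min 0 (minGain Φ b n x) : ℤ) : ℝ))
    (hcast.comp (measurable_const.min hW)) (K := (n + 1) * K)
    (fun x => by exact_mod_cast hmb x)
  have h1 : ∫ x, (minGain Φ b (n + 1) x : ℝ) ∂μ =
      ∫ x, (stepGain Φ b x : ℝ) ∂μ + ∫ x, ((min 0 (minGain Φ b n x) : ℤ) : ℝ) ∂μ := by
    rw [← hT, ← integral_add i1 i6]
    congr 1
    ext x
    rw [minGain]
    push_cast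
    rfl
  have h2 : ∫ x, (minGain Φ b n x : ℝ) ∂μ = ∫ x, ((min 0 (minGain Φ b n x) : ℤ) : ℝ) ∂μ +
      ∫ x, ((max 0 (minGain Φ b n x) : ℤ) : ℝ) ∂μ := by
    rw [← integral_add i2 i3]
    congr 1
    ext x
    rw [← Int.cast_add, min_add_max, zero_add]
  have h3 : ∫ x, (minGain Φ b (n + 1) x : ℝ) ∂μ ≤ ∫ x, (minGain Φ b n x : ℝ) ∂μ :=
    integral_mono i4 i5 fun x => Int.cast_le.2 (minGain_succ_le n x)
  linarith

/-- The rays all of whose positive gains exceed `l`. -/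
def gainSet (Φ : F k ≃* F k) (b : Boundary k → Boundary k) (l : ℕ) : Set (Boundary k) :=
  {x | ∀ j, (l : ℤ) < gain Φ b (j + 1) x}

theorem measurableSet_gainSet (hb : IsBdryExt k Φ b) (l : ℕ) :
    MeasurableSet (gainSet Φ b l) := by
  rw [show gainSet Φ b l = ⋂ j, {x | (l : ℤ) < gain Φ b (j + 1) x} by ext; simp [gainSet]]
  exact MeasurableSet.iInter fun j => measurableSet_lt measurable_const (measurable_gain hb _)

theorem integral_stepGain_le (hμ : IsUniform μ) (hb : IsBdryExt k Φ b) :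
    ∃ K : ℕ, ∫ x, (stepGain Φ b x : ℝ) ∂μ ≤ ∑ l ∈ Finset.range K, μ.real (gainSet Φ b l) := by
  have := hμ.prob
  obtain ⟨K, hK⟩ := exists_stepGain_le Φ b
  refine ⟨K, ?_⟩
  set S : ℕ → ℕ → Set (Boundary k) := fun l n => {x | (l : ℤ) < minGain Φ b n x} with hS
  have hSm : ∀ l n, MeasurableSet (S l n) := fun l n =>
    measurableSet_lt measurable_const (measurable_minGain hb n)
  have h1 : ∀ n, ∫ x, (stepGain Φ b x : ℝ) ∂μ ≤ ∑ l ∈ Finset.range K, μ.real (S l n) := by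
    intro n
    refine (integral_stepGain_le_posPart hμ hb n).trans (le_of_eq ?_)
    have h2 : ∀ x, ((max 0 (minGain Φ b n x) : ℤ) : ℝ) =
        ∑ l ∈ Finset.range K, (S l n).indicator (1 : Boundary k → ℝ) x := by
      intro x
      have hle := minGain_le hK n x
      obtain ⟨m, hm⟩ : ∃ m : ℕ, max 0 (minGain Φ b n x) = m :=
        ⟨_, (Int.toNat_of_nonneg (le_max_left _ _)).symm⟩
      have h3 : ∀ l, (S l n).indicator (1 : Boundary k → ℝ) x = if l < m then 1 else 0 := by
        intro l
        have : x ∈ S l n ↔ l < m := by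
          change (l : ℤ) < minGain Φ b n x ↔ _
          omega
        simp only [Set.indicator, this, Pi.one_apply]
      simp only [h3]
      rw [hm, ← Finset.sum_filter, Finset.sum_const, nsmul_eq_mul, mul_one]
      have h4 : (Finset.range K).filter (· < m) = Finset.range m := by
        ext l
        simp only [Finset.mem_filter, Finset.mem_range]
        omega
      rw [h4, Finset.card_range]
      simp
    simp only [h2]
    have hi : ∀ l, Integrable ((S l n).indicator (1 : Boundary k → ℝ)) μ := fun l =>
      (integrable_const (1 : ℝ)).indicator (hSm l n)
    rw [integral_finsetSum _ fun l _ => hi l]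
    exact Finset.sum_congr rfl fun l _ => integral_indicator_one (hSm l n)
  have h2 : Tendsto (fun n => ∑ l ∈ Finset.range K, μ.real (S l n)) atTop
      (𝓝 (∑ l ∈ Finset.range K, μ.real (⋂ n, S l n))) := by
    refine tendsto_finsetSum _ fun l _ => ?_
    refine (ENNReal.tendsto_toReal (measure_ne_top _ _)).comp
      (tendsto_measure_iInter_atTop (fun n => (hSm l n).nullMeasurableSet) ?_
        ⟨0, measure_ne_top _ _⟩)
    exact antitone_nat_of_succ_le fun n x hx => lt_of_lt_of_le hx (minGain_succ_le n x)
  refine (ge_of_tendsto' h2 h1).trans (Finset.sum_le_sum fun l _ => measureReal_mono ?_)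
  intro x hx j
  exact lt_of_lt_of_le (Set.mem_iInter.1 hx j) (minGain_le_gain hb le_rfl x)

/-! ### The transport argument -/

theorem exists_prefixEl_of_separated {f : F k} (hf : f ≠ 1) {ξ η : Boundary k}
    (h : ξ.1 0 ≠ η.1 0) (hf' : (act k f ξ).1 0 ≠ (act k f η).1 0) :
    ∃ j, f⁻¹ = prefixEl k η (j + 1) ∨ f = prefixEl k (act k f η) (j + 1) := by
  set l := f.toWord with hl
  have hr : FreeGroup.IsReduced l := FreeGroup.isReduced_toWord
  have hfl : FreeGroup.mk l = f := FreeGroup.mk_toWord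
  have h0 : l ≠ [] := fun h => hf (by rw [← hfl, h]; rfl)
  obtain ⟨j, hj⟩ := Nat.exists_eq_succ_of_ne_zero (mt List.length_eq_zero_iff.1 h0)
  refine ⟨j, ?_⟩
  have hpre : ∀ (m : List (L k)) (y : Boundary k), m.length = j + 1 → y ∈ LC m →
      FreeGroup.mk m = prefixEl k y (j + 1) := fun m y hm hy => by
    rw [mem_LC_iff_pre, hm] at hy
    rw [prefixEl_eq, hy]
  by_cases hc : ∀ c ∈ l.getLast?, η.1 0 ≠ linv k c
  · right
    have := act_mk_mem_LC hr hc
    rw [hfl] at this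
    rw [← hpre l _ hj this, hfl]
  · left
    push Not at hc
    obtain ⟨c, hc, hηc⟩ := hc
    have h1 := act_mk_mem_LC hr (x := ξ) (fun c' hc' => by
      rw [Option.mem_def] at hc hc'
      rw [hc] at hc'
      rw [← Option.some_injective _ hc', ← hηc]
      exact h)
    rw [hfl] at h1
    have h2 := act_mk_mem_LC (isReduced_invRev hr) (x := act k f η) (fun c' hc' => by
      rw [← LC_zero_of_mem h1 (getLast?_invRev hc')]
      exact hf'.symm)
    rw [← FreeGroup.inv_mk, hfl, act_inv_act] at h2
    rw [← hpre _ _ (by rw [FreeGroup.invRev_length, hj]) h2, ← FreeGroup.inv_mk, hfl]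

theorem exists_separating {X Y : Boundary k} (h : X ≠ Y) :
    ∃ w : F k, (act k w X).1 0 ≠ (act k w Y).1 0 := by
  by_contra! hw
  have key : ∀ n X' Y', (∃ w, X' = act k w X ∧ Y' = act k w Y) → X'.1 n = Y'.1 n := by
    intro n
    induction n with
    | zero =>
      rintro X' Y' ⟨w, rfl, rfl⟩
      exact hw w
    | succ n ih =>
      rintro X' Y' ⟨w, h1, h2⟩
      refine ih (Tmap k X') (Tmap k Y') ⟨(el k (X'.1 0))⁻¹ * w, ?_, ?_⟩
      · rw [act_mul, ← h1, act_el_inv_of_eq rfl]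
      · rw [act_mul, ← h2, act_el_inv_of_eq]
        rw [h1, h2]
        exact (hw w).symm
  exact h (Boundary.ext_letters fun n => key n X Y ⟨1, by simp, by simp⟩)

theorem exists_separating_coc {X Y : Boundary k} (h : X ≠ Y) (n : ℤ) :
    ∃ w : F k, (act k w X).1 0 ≠ (act k w Y).1 0 ∧ coc w Y = n := by
  obtain ⟨w, hw⟩ := exists_separating h
  induction n using Int.inductionOn' (b := coc w Y) with
  | zero => exact ⟨w, hw, rfl⟩
  | succ n _ ih =>
    obtain ⟨v, hv, hn⟩ := ih
    refine ⟨(el k ((act k v X).1 0))⁻¹ * v, ?_, ?_⟩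
    · rw [act_mul, act_mul, act_el_inv_of_eq rfl, act_el_inv_zero_of_ne hv.symm]
      exact Tmap_zero_ne _
    · rw [coc_mul, coc_el_inv, if_neg hv.symm, hn, add_comm]
  | pred n _ ih =>
    obtain ⟨v, hv, hn⟩ := ih
    refine ⟨(el k ((act k v Y).1 0))⁻¹ * v, ?_, ?_⟩
    · rw [act_mul, act_mul, act_el_inv_of_eq (x := act k v Y) rfl, act_el_inv_zero_of_ne hv]
      exact (Tmap_zero_ne _).symm
    · rw [coc_mul, coc_el_inv, if_pos rfl, hn]; ring

theorem mem_baseBall {p : Boundary k × Boundary k} : p ∈ baseBall k ↔ p.1.1 0 ≠ p.2.1 0 := by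
  simp [baseBall, baseCyl, Cyl_eq_LC]

theorem measurableSet_baseBall : MeasurableSet (baseBall k) := by
  have h0 : Measurable fun x : Boundary k => x.1 0 :=
    measurable_to_countable' fun a => measurableSet_letter 0 a
  have : baseBall k = {p | p.1.1 0 = p.2.1 0}ᶜ := by ext p; simp [mem_baseBall]
  rw [this]
  exact (measurableSet_eq_fun (h0.comp measurable_fst) (h0.comp measurable_snd)).compl

variable {η : Measure (Boundary k × Boundary k)}

/-- The uniform current, specified by invariance and its values on based cylinders. -/
structure IsUniformCurrent (μ : Measure (Boundary k)) (η : Measure (Boundary k × Boundary k)) :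
    Prop where
  invariant : ∀ g : F k, ∀ W : Set (Boundary k × Boundary k), MeasurableSet W →
    η (actPair k g ⁻¹' W) = η W
  apply_baseCyl : ∀ w : F k, η (baseCyl k w) = μ (Cyl k w)

theorem IsUniformCurrent.apply_inter (hμ : IsUniform μ) (hη : IsUniformCurrent μ η)
    {Z : Set (Boundary k)} (hZ : MeasurableSet Z) :
    η (baseBall k ∩ Prod.snd ⁻¹' Z) = μ Z := by
  have := hμ.prob
  have h : μ = (η.restrict (baseBall k)).map Prod.snd := by
    refine measure_ext_LC fun l hl _ => ?_
    rw [Measure.map_apply measurable_snd (measurableSet_LC l),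
      Measure.restrict_apply (measurable_snd (measurableSet_LC l))]
    have h1 := hη.apply_baseCyl (FreeGroup.mk l)
    rw [Cyl_eq_LC, toWord_mk_of_isReduced hl] at h1
    rw [← h1]
    congr 1
    ext p
    simp only [baseCyl, Cyl_eq_LC, toWord_mk_of_isReduced hl, Set.mem_inter_iff, Set.mem_preimage,
      mem_baseBall, Set.mem_ofPred_eq, and_comm]
  conv_rhs => rw [h]
  rw [Measure.map_apply measurable_snd hZ, Measure.restrict_apply (measurable_snd hZ),
    Set.inter_comm]

/-- Pairs leaving the base point in distinct directions before and after applying `b ∘ g⁻¹`,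
positioned at height `l` and beyond which the gain stays above `l`. -/
def crossing (Φ : F k ≃* F k) (b : Boundary k → Boundary k) (g : F k) (l : ℕ) :
    Set (Boundary k × Boundary k) :=
  (baseBall k ∩ (fun p => (b (act k g⁻¹ p.1), b (act k g⁻¹ p.2))) ⁻¹' baseBall k) ∩
    Prod.snd ⁻¹' (gainSet Φ b l ∩ {y | bcoc Φ b g (act k g⁻¹ y) = l})

theorem measurableSet_crossing (hb : IsBdryExt k Φ b) (g : F k) (l : ℕ) :
    MeasurableSet (crossing Φ b g l) := by
  refine (measurableSet_baseBall.inter (Measurable.prodMk ?_ ?_ measurableSet_baseBall)).inter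
    (measurable_snd ((measurableSet_gainSet hb l).inter ?_))
  · exact hb.measurable.comp ((measurable_act _).comp measurable_fst)
  · exact hb.measurable.comp ((measurable_act _).comp measurable_snd)
  · exact ((measurable_bcoc hb g).comp (measurable_act _)) (measurableSet_singleton _)

theorem measurable_actPair (g : F k) : Measurable (actPair k g) :=
  ((measurable_act g).comp measurable_fst).prodMk ((measurable_act g).comp measurable_snd)

theorem actPair_mem_crossing {g : F k} {l : ℕ} {p : Boundary k × Boundary k} :
    actPair k g p ∈ crossing Φ b g l ↔
      (act k g p.1).1 0 ≠ (act k g p.2).1 0 ∧ (b p.1).1 0 ≠ (b p.2).1 0 ∧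
        act k g p.2 ∈ gainSet Φ b l ∧ bcoc Φ b g p.2 = l := by
  simp [crossing, actPair, mem_baseBall, and_assoc]

theorem subset_iUnion_crossing (hb : IsBdryExt k Φ b) (l : ℕ) :
    baseBall k ∩ Prod.snd ⁻¹' gainSet Φ b l ⊆ ⋃ g, crossing Φ b g l := by
  rintro ⟨ξ, y⟩ ⟨h1, h2⟩
  rw [mem_baseBall] at h1
  obtain ⟨w, hw, hc⟩ := exists_separating_coc (hb.ne_of_zero_ne h1) (-(l : ℤ))
  refine Set.mem_iUnion.2 ⟨(Φ.symm w)⁻¹, ⟨mem_baseBall.2 h1, ?_⟩, h2, ?_⟩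
  · rw [Set.mem_preimage, mem_baseBall]
    simpa [hb.act] using hw
  · have := bcoc_inv hb (Φ.symm w) y
    simp only [Set.mem_ofPred_eq, inv_inv]
    rw [bcoc_inv hb, act_inv_act, bcoc, MulEquiv.apply_symm_apply, hc, neg_neg]

theorem pairwise_disjoint_crossing (hb : IsBdryExt k Φ b) :
    Pairwise (Function.onFun Disjoint fun i : F k × ℕ =>
      actPair k i.1 ⁻¹' crossing Φ b i.1 i.2) := by
  rintro ⟨g, l⟩ ⟨h, m⟩ hne
  refine Set.disjoint_left.2 fun p hp hp' => hne ?_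
  simp only [Set.mem_preimage, actPair_mem_crossing] at hp hp'
  obtain ⟨h1, -, h3, h4⟩ := hp
  obtain ⟨h1', -, h3', h4'⟩ := hp'
  by_cases hgh : g = h
  · subst hgh
    simp only [Prod.mk.injEq, true_and]
    omega
  exfalso
  have hf : h * g⁻¹ ≠ 1 := fun h0 => hgh (mul_inv_eq_one.1 h0).symm
  have hact : ∀ y, act k (h * g⁻¹) (act k g y) = act k h y := fun y => by
    rw [act_mul, act_inv_act]
  have hg : bcoc Φ b g⁻¹ (act k g p.2) = -l := by rw [bcoc_inv hb, act_inv_act, h4]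
  have hh : bcoc Φ b h⁻¹ (act k h p.2) = -m := by rw [bcoc_inv hb, act_inv_act, h4']
  obtain ⟨j, hj | hj⟩ := exists_prefixEl_of_separated hf h1 (by rwa [hact, hact])
  · have h5 := h3 j
    rw [gain, ← hj, inv_inv, bcoc_mul hb, act_inv_act, h4', hg] at h5
    omega
  · rw [hact] at hj
    have h5 := h3' j
    rw [gain, ← hj, mul_inv_rev, inv_inv, bcoc_mul hb, act_inv_act, h4, hh] at h5
    omega

/-- The total measure of the gain sets is bounded by the length. -/
theorem sum_gainSet_le (hμ : IsUniform μ) (hη : IsUniformCurrent μ η) (hb : IsBdryExt k Φ b)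
    (K : ℕ) : ∑ l ∈ Finset.range K, μ (gainSet Φ b l) ≤ autLen k η b := by
  have hE : ∀ i : F k × ℕ, MeasurableSet (actPair k i.1 ⁻¹' crossing Φ b i.1 i.2) := fun i =>
    measurable_actPair _ (measurableSet_crossing hb _ _)
  calc ∑ l ∈ Finset.range K, μ (gainSet Φ b l)
      ≤ ∑ l ∈ Finset.range K, ∑' g, η (actPair k g ⁻¹' crossing Φ b g l) := by
        refine Finset.sum_le_sum fun l _ => ?_
        rw [← hη.apply_inter hμ (measurableSet_gainSet hb l)]
        refine (measure_mono (subset_iUnion_crossing hb l)).trans ((measure_iUnion_le _).trans ?_)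
        refine le_of_eq (tsum_congr fun g => (hη.invariant g _ (measurableSet_crossing hb g l)).symm)
    _ ≤ ∑' l, ∑' g, η (actPair k g ⁻¹' crossing Φ b g l) := ENNReal.sum_le_tsum _
    _ = ∑' i : F k × ℕ, η (actPair k i.1 ⁻¹' crossing Φ b i.1 i.2) := by
        rw [ENNReal.tsum_comm, ENNReal.tsum_prod']
    _ = η (⋃ i : F k × ℕ, actPair k i.1 ⁻¹' crossing Φ b i.1 i.2) :=
        (measure_iUnion (pairwise_disjoint_crossing hb) hE).symm
    _ ≤ autLen k η b := by
        refine measure_mono (Set.iUnion_subset fun i p hp => ?_)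
        rw [Set.mem_preimage, actPair_mem_crossing] at hp
        exact mem_baseBall.2 hp.2.1

theorem integral_stepGain_le_autLen (hμ : IsUniform μ) (hη : IsUniformCurrent μ η)
    (hb : IsBdryExt k Φ b) (hfin : autLen k η b ≠ ⊤) :
    ∫ x, (stepGain Φ b x : ℝ) ∂μ ≤ (autLen k η b).toReal := by
  have := hμ.prob
  obtain ⟨K, hK⟩ := integral_stepGain_le hμ hb
  refine hK.trans ?_
  have h := ENNReal.toReal_mono hfin (sum_gainSet_le hμ hη hb K)
  rwa [ENNReal.toReal_sum fun _ _ => measure_ne_top _ _] at h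

end LengthBound

/-! ### Recentering an automorphism at its median -/

section Median

variable {Φ : F k ≃* F k} {b : Boundary k → Boundary k} {μ : Measure (Boundary k)}

theorem act_prefixEl_inv (y : Boundary k) (n : ℕ) :
    (act k (prefixEl k y n)⁻¹ y) = (Tmap k)^[n] y := by
  induction n generalizing y with
  | zero => simp [prefixEl_zero]
  | succ n ih =>
    rw [prefixEl_succ, mul_inv_rev, act_mul, act_el_inv_of_eq rfl, ih, Function.iterate_succ_apply]

theorem iterate_Tmap_zero (y : Boundary k) (n : ℕ) : ((Tmap k)^[n] y).1 0 = y.1 n := by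
  induction n generalizing y with
  | zero => rfl
  | succ n ih => rw [Function.iterate_succ_apply, ih]; rfl

theorem act_mk_inv_zero_ne {l : List (L k)} {y : Boundary k} (hy : y ∈ LC l) {c : L k}
    (hc : c ∈ l.getLast?) : (act k (FreeGroup.mk l)⁻¹ y).1 0 ≠ linv k c := by
  rw [mem_LC_iff_pre] at hy
  obtain ⟨n, hn⟩ : ∃ n, l.length = n + 1 :=
    Nat.exists_eq_succ_of_ne_zero fun h => by simp [List.length_eq_zero_iff.1 h] at hc
  rw [hn] at hy
  have h1 : FreeGroup.mk l = prefixEl k y (n + 1) := by rw [prefixEl_eq, hy]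
  rw [h1, act_prefixEl_inv, iterate_Tmap_zero]
  rw [← hy, getLast?_pre, Option.mem_some_iff] at hc
  rw [← hc]
  exact y.2 n

theorem inter_nonempty_of_half_lt [IsProbabilityMeasure μ] {s t : Set (Boundary k)}
    (ht : MeasurableSet t) (h1 : 1 / 2 < μ.real s) (h2 : 1 / 2 < μ.real t) :
    (s ∩ t).Nonempty := by
  by_contra h
  have hd := Set.disjoint_iff_inter_eq_empty.2 (Set.not_nonempty_iff_eq_empty.1 h)
  have h3 := measureReal_union (μ := μ) hd ht
  have h4 := measureReal_le_one (μ := μ) (s := s ∪ t)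
  linarith

theorem exists_length_bound_of_half_lt (hμ : IsUniform μ) (hb : IsBdryExt k Φ b) :
    ∃ n, ∀ l : List (L k), l.length = n → μ.real (b ⁻¹' LC l) ≤ 1 / 2 := by
  have := hμ.prob
  by_contra! h
  choose w hwl hw using h
  have hm : ∀ n, MeasurableSet (b ⁻¹' LC (w n)) := fun n => hb.measurable (measurableSet_LC _)
  have hanti : Antitone fun n => b ⁻¹' LC (w n) := by
    refine antitone_nat_of_succ_le fun n => Set.preimage_mono ?_
    obtain ⟨x, h1, h2⟩ := inter_nonempty_of_half_lt (hm (n + 1)) (hw n) (hw (n + 1))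
    exact LC_subset_of_inter (by rw [hwl, hwl]; omega) ⟨b x, h1, h2⟩
  have hlim : Tendsto (fun n => μ.real (b ⁻¹' LC (w n))) atTop
      (𝓝 (μ.real (⋂ n, b ⁻¹' LC (w n)))) :=
    (ENNReal.tendsto_toReal (measure_ne_top _ _)).comp
      (tendsto_measure_iInter_atTop (fun n => (hm n).nullMeasurableSet) hanti
        ⟨0, measure_ne_top _ _⟩)
  have hsub : (⋂ n, b ⁻¹' LC (w n)).Subsingleton := by
    intro x hx x' hx'
    rw [Set.mem_iInter] at hx hx'
    refine hb.injective (Boundary.ext_letters fun n => ?_)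
    have h1 := mem_LC_iff_pre.1 (hx (n + 1))
    have h2 := mem_LC_iff_pre.1 (hx' (n + 1))
    rw [hwl] at h1 h2
    rw [← h2] at h1
    have h3 := congrArg List.getLast? h1
    rw [getLast?_pre, getLast?_pre] at h3
    exact Option.some_injective _ h3
  have h0 : μ.real (⋂ n, b ⁻¹' LC (w n)) = 0 := by
    rcases hsub.eq_empty_or_singleton with h | ⟨x, h⟩ <;> rw [h]
    · simp
    · rw [measureReal_def, hμ.singleton_eq_zero]; rfl
  have h1 := ge_of_tendsto' hlim fun n => (hw n).le
  rw [h0] at h1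
  norm_num at h1

theorem exists_median (hμ : IsUniform μ) (hb : IsBdryExt k Φ b) :
    ∃ p : F k, ∀ a, μ.real ((fun x => act k p (b x)) ⁻¹' LC [a]) ≤ 1 / 2 := by
  have := hμ.prob
  classical
  have hex := exists_length_bound_of_half_lt hμ hb
  obtain ⟨n, hn⟩ : ∃ n, Nat.find hex = n + 1 := by
    refine Nat.exists_eq_succ_of_ne_zero fun h => ?_
    have h1 := Nat.find_spec hex [] (by rw [h]; rfl)
    rw [LC_nil, Set.preimage_univ, probReal_univ] at h1
    norm_num at h1
  have hmax := Nat.find_spec hex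
  rw [hn] at hmax
  obtain ⟨v, hvn, hv⟩ : ∃ v : List (L k), v.length = n ∧ 1 / 2 < μ.real (b ⁻¹' LC v) := by
    have := Nat.find_min hex (m := n) (by omega)
    push Not at this
    exact this
  have hvr : FreeGroup.IsReduced v := by
    by_contra h
    rw [LC_eq_empty h, Set.preimage_empty, measureReal_empty] at hv
    norm_num at hv
  refine ⟨(FreeGroup.mk v)⁻¹, fun a => ?_⟩
  by_cases ha : ∃ c ∈ v.getLast?, a = linv k c
  · obtain ⟨c, hc, rfl⟩ := ha
    have hsub : (fun x => act k (FreeGroup.mk v)⁻¹ (b x)) ⁻¹' LC [linv k c] ⊆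
        (b ⁻¹' LC v)ᶜ := by
      intro x hx hx'
      rw [Set.mem_preimage, LC_singleton] at hx
      exact act_mk_inv_zero_ne hx' hc hx
    have h1 := probReal_compl_eq_one_sub (μ := μ) (hb.measurable (measurableSet_LC v))
    have h2 := measureReal_mono (μ := μ) hsub
    linarith
  · push Not at ha
    refine le_trans (measureReal_mono (μ := μ) ?_) (hmax (v ++ [a]) (by simp [hvn]))
    intro x hx
    rw [Set.mem_preimage, LC_singleton] at hx
    set z := act k (FreeGroup.mk v)⁻¹ (b x) with hz
    have hr : FreeGroup.IsReduced (v ++ [a]) := by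
      rw [isReduced_append_iff]
      refine ⟨hvr, by simp, fun c hc d hd => ?_⟩
      simp only [List.head?_cons, Option.mem_some_iff] at hd
      rw [← hd]
      exact ha c hc
    have h1 := act_mk_mem_LC hr (x := Tmap k z) (by
      intro c hc
      simp only [List.getLast?_append, List.getLast?_singleton, Option.some_or,
        Option.mem_some_iff] at hc
      rw [← hc, ← show z.1 0 = a from hx]
      exact Tmap_zero_ne _)
    rw [mk_append, act_mul] at h1
    have h2 : act k (FreeGroup.mk [a]) (Tmap k z) = z := by
      rw [← show z.1 0 = a from hx]
      exact act_el_Tmap _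
    rw [h2, hz, act_act_inv] at h1
    exact h1

variable {η : Measure (Boundary k × Boundary k)}

theorem autLen_comp_act (hη : IsUniformCurrent μ η) (hb : IsBdryExt k Φ b) (p : F k) :
    autLen k η (fun x => act k p (b x)) = autLen k η b := by
  have hmeas : MeasurableSet (pairMap k b ⁻¹' baseBall k) :=
    (((hb.measurable).comp measurable_fst).prodMk ((hb.measurable).comp measurable_snd))
      measurableSet_baseBall
  rw [autLen, autLen, ← hη.invariant (Φ.symm p) _ hmeas]
  congr 1
  ext q
  simp [pairMap, actPair, hb.act]

end Median

/-! ### Lengths of powers, conjugates and commutators -/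

section Words

theorem exists_norm_pow (x : F k) :
    ∃ c w : ℕ, ∀ n, (x ^ (n + 1)).norm = 2 * c + (n + 1) * w := by
  refine ⟨(FreeGroup.reduceCyclically.conjugator x.toWord).length,
    (FreeGroup.reduceCyclically x.toWord).length, fun n => ?_⟩
  rw [FreeGroup.norm, FreeGroup.toWord_pow,
    FreeGroup.reduceCyclically.reduce_flatten_replicate_succ FreeGroup.isReduced_toWord]
  simp [FreeGroup.invRev_length]
  ring

theorem norm_le_norm_sq (x : F k) : x.norm ≤ (x ^ 2).norm := by
  obtain ⟨c, w, h⟩ := exists_norm_pow x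
  have h0 := h 0
  have h1 := h 1
  simp only [zero_add, pow_one, one_mul] at h0
  norm_num at h1
  omega

theorem norm_sq_le (x g : F k) : (x ^ 2).norm ≤ x.norm + (g * x * g⁻¹).norm := by
  obtain ⟨c, w, h⟩ := exists_norm_pow x
  obtain ⟨c', w', h'⟩ := exists_norm_pow (g * x * g⁻¹)
  have h0 := h 0
  have h1 := h 1
  have h0' := h' 0
  simp only [zero_add, pow_one, one_mul] at h0 h0'
  norm_num at h1
  suffices w ≤ w' by omega
  by_contra! hlt
  set n := 2 * c' + 2 * g.norm with hn
  have h2 := h n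
  have h2' := h' n
  have h3 : (x ^ (n + 1)).norm ≤ 2 * g.norm + ((g * x * g⁻¹) ^ (n + 1)).norm := by
    rw [conj_pow]
    calc (x ^ (n + 1)).norm = (g⁻¹ * (g * x ^ (n + 1) * g⁻¹) * g).norm := by group
      _ ≤ (g⁻¹).norm + (g * x ^ (n + 1) * g⁻¹).norm + g.norm :=
        (FreeGroup.norm_mul_le _ _).trans (Nat.add_le_add_right (FreeGroup.norm_mul_le _ _) _)
      _ = _ := by rw [FreeGroup.norm_inv_eq]; ring
  have h4 : (n + 1) * (w' + 1) ≤ (n + 1) * w := Nat.mul_le_mul_left _ hlt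
  rw [mul_add, mul_one] at h4
  omega

theorem take_toWord_mul (g d : F k) {m : ℕ} (h : m + d.norm ≤ g.norm) :
    (g * d).toWord.take m = g.toWord.take m := by
  obtain ⟨r, u, v, h1, h2, h3⟩ := exists_common_prefix (g⁻¹).toWord d.toWord
  have hr1 : FreeGroup.IsReduced (r ++ u) := h1 ▸ FreeGroup.isReduced_toWord
  have hr2 : FreeGroup.IsReduced (r ++ v) := h2 ▸ FreeGroup.isReduced_toWord
  have hg : g = (FreeGroup.mk (r ++ u))⁻¹ := by rw [← h1, FreeGroup.mk_toWord, inv_inv]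
  have hd : d = FreeGroup.mk (r ++ v) := by rw [← h2, FreeGroup.mk_toWord]
  have hw : (g * d).toWord = FreeGroup.invRev u ++ v := by
    rw [hg, hd, mk_append_inv_mul, toWord_inv_mul_of_diverge (isReduced_append_iff.1 hr1).2.1
      (isReduced_append_iff.1 hr2).2.1 h3]
  have hgw : g.toWord = FreeGroup.invRev u ++ FreeGroup.invRev r := by
    rw [hg, FreeGroup.toWord_inv, toWord_mk_of_isReduced hr1, FreeGroup.invRev_append]
  have hm : m ≤ (FreeGroup.invRev u).length := by
    have hdn : d.norm = r.length + v.length := by rw [FreeGroup.norm, h2, List.length_append]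
    have hgn : g.norm = u.length + r.length := by
      rw [FreeGroup.norm, hgw, List.length_append, FreeGroup.invRev_length,
        FreeGroup.invRev_length]
    rw [FreeGroup.invRev_length]
    omega
  rw [hw, hgw, List.take_append_of_le_length hm, List.take_append_of_le_length hm]

/-- An element moving both ends of a long segment a short distance shifts its middle part. -/
theorem exists_shift {x γ : F k} {N : ℕ} (h1 : γ.norm ≤ N) (h2 : (x⁻¹ * γ * x).norm ≤ N) :
    ∃ τ : ℤ, |τ| ≤ N ∧ ∀ m m' : ℕ, N ≤ m → m + 2 * N ≤ x.norm → (m' : ℤ) = m + τ →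
      γ * FreeGroup.mk (x.toWord.take m) = FreeGroup.mk (x.toWord.take m') := by
  obtain ⟨r, u, v, hγ, hx, hdiv⟩ := exists_common_prefix (γ⁻¹).toWord x.toWord
  have hr1 : FreeGroup.IsReduced (r ++ u) := hγ ▸ FreeGroup.isReduced_toWord
  have hr2 : FreeGroup.IsReduced (r ++ v) := hx ▸ FreeGroup.isReduced_toWord
  have hu := (isReduced_append_iff.1 hr1).2.1
  have hv := (isReduced_append_iff.1 hr2).2.1
  have hγ' : γ = (FreeGroup.mk (r ++ u))⁻¹ := by rw [← hγ, FreeGroup.mk_toWord, inv_inv]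
  have hγn : γ.norm = r.length + u.length := by
    rw [← FreeGroup.norm_inv_eq, FreeGroup.norm, hγ, List.length_append]
  have hxx : x = FreeGroup.mk (r ++ v) := by rw [← hx, FreeGroup.mk_toWord]
  have hw : (γ * x).toWord = FreeGroup.invRev u ++ v := by
    rw [hγ', hxx, mk_append_inv_mul, toWord_inv_mul_of_diverge hu hv hdiv]
  refine ⟨(u.length : ℤ) - r.length, by rw [abs_le]; omega, fun m m' hm hm2 hm' => ?_⟩
  have hlen : m' = u.length + (m - r.length) := by omega
  have h3 : γ * FreeGroup.mk (x.toWord.take m) =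
      FreeGroup.mk (FreeGroup.invRev u ++ v.take (m - r.length)) := by
    rw [hx, List.take_append, List.take_of_length_le (by omega), hγ', mk_append_inv_mul,
      FreeGroup.inv_mk, FreeGroup.mul_mk]
  have h4 := take_toWord_mul x (x⁻¹ * γ * x) (m := m') (by omega)
  rw [show x * (x⁻¹ * γ * x) = γ * x by group, hw, hlen, List.take_append,
    List.take_of_length_le (by rw [FreeGroup.invRev_length]; omega), FreeGroup.invRev_length,
    Nat.add_sub_cancel_left] at h4
  rw [h3, h4, hlen]

theorem mul_comm_of_norm_le {x γ₁ γ₂ : F k} {N : ℕ} (hx : 5 * N ≤ x.norm)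
    (h1 : γ₁.norm ≤ N) (h1' : (x⁻¹ * γ₁ * x).norm ≤ N)
    (h2 : γ₂.norm ≤ N) (h2' : (x⁻¹ * γ₂ * x).norm ≤ N) : γ₁ * γ₂ = γ₂ * γ₁ := by
  obtain ⟨s, hs, hs'⟩ := exists_shift h1 h1'
  obtain ⟨t, ht, ht'⟩ := exists_shift h2 h2'
  rw [abs_le] at hs ht
  obtain ⟨ms, hms⟩ : ∃ ms : ℕ, (ms : ℤ) = (2 * N : ℕ) + s := ⟨(2 * N + s).toNat, by omega⟩
  obtain ⟨mt, hmt⟩ : ∃ mt : ℕ, (mt : ℤ) = (2 * N : ℕ) + t := ⟨(2 * N + t).toNat, by omega⟩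
  obtain ⟨m, hm⟩ : ∃ m : ℕ, (m : ℤ) = (2 * N : ℕ) + s + t := ⟨(2 * N + s + t).toNat, by omega⟩
  have e1 := hs' (2 * N) ms (by omega) (by omega) hms
  have e2 := ht' (2 * N) mt (by omega) (by omega) hmt
  have e3 := hs' mt m (by omega) (by omega) (by omega)
  have e4 := ht' ms m (by omega) (by omega) (by omega)
  rw [← e2, ← mul_assoc] at e3
  rw [← e1, ← mul_assoc, ← e3] at e4
  exact (mul_right_cancel e4).symm

set_option maxRecDepth 10000 in
theorem commutators_not_commute {i j : Fin k} (h : i ≠ j) {a v : F k} (ha : a = FreeGroup.of i)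
    (hv : v = FreeGroup.of j * a * (FreeGroup.of j)⁻¹) :
    (a * v * a⁻¹ * v⁻¹) * (a * v⁻¹ * a⁻¹ * v) ≠ (a * v⁻¹ * a⁻¹ * v) * (a * v * a⁻¹ * v⁻¹) := by
  intro h0
  let φ : F k →* Equiv.Perm (Fin 4) := FreeGroup.lift fun l =>
    if l = i then finRotate 4 else Equiv.swap 2 3
  have hi : φ a = finRotate 4 := by simp [φ, ha]
  have hj : φ (FreeGroup.of j) = Equiv.swap 2 3 := by simp [φ, h.symm]
  have h1 := congrArg φ h0
  simp only [map_mul, map_inv, hv, hi, hj] at h1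
  revert h1
  decide

end Words

/-! ### Points of small displacement lie near a line -/

section Line

variable {Φ : F k ≃* F k} {b : Boundary k → Boundary k} {μ : Measure (Boundary k)}

/-- A word whose cylinder has almost half of the mass of the image of `μ`. -/
def Heavy (μ : Measure (Boundary k)) (b : Boundary k → Boundary k) (l : List (L k)) : Prop :=
  2 / 5 ≤ μ.real (b ⁻¹' LC l)

theorem heavy_nil [IsProbabilityMeasure μ] : Heavy μ b [] := by
  rw [Heavy, LC_nil, Set.preimage_univ, probReal_univ]
  norm_num

theorem Heavy.take [IsFiniteMeasure μ] {l : List (L k)} (h : Heavy μ b l) (n : ℕ) :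
    Heavy μ b (l.take n) := by
  refine le_trans h (measureReal_mono (Set.preimage_mono ?_))
  conv_lhs => rw [← List.take_append_drop n l]
  exact LC_append_subset _ _

theorem Heavy.head [IsFiniteMeasure μ] {l : List (L k)} (h : Heavy μ b l) {a : L k}
    (ha : a ∈ l.head?) : Heavy μ b [a] := by
  cases l with
  | nil => simp at ha
  | cons c l =>
    simp only [List.head?_cons, Option.mem_some_iff] at ha
    rw [← ha]
    exact h.take 1

theorem not_three_heavy [IsProbabilityMeasure μ] (hb : IsBdryExt k Φ b) {a c d : L k}
    (ha : Heavy μ b [a]) (hc : Heavy μ b [c]) (hd : Heavy μ b [d])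
    (hac : a ≠ c) (had : a ≠ d) (hcd : c ≠ d) : False := by
  have hm : ∀ a, MeasurableSet (b ⁻¹' LC [a]) := fun a => hb.measurable (measurableSet_LC _)
  have hdis : ∀ {a c : L k}, a ≠ c → Disjoint (b ⁻¹' LC [a]) (b ⁻¹' LC [c]) := by
    intro a c h
    refine Disjoint.preimage _ (Set.disjoint_left.2 fun x h1 h2 => h ?_)
    rw [LC_singleton] at h1 h2
    exact h1.symm.trans h2
  have h1 := measureReal_union (μ := μ) (hdis hac) (hm c)
  have h2 := measureReal_union (μ := μ) (Disjoint.union_left (hdis had) (hdis hcd)) (hm d)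
  have h3 := measureReal_le_one (μ := μ) (s := b ⁻¹' LC [a] ∪ b ⁻¹' LC [c] ∪ b ⁻¹' LC [d])
  rw [Heavy] at ha hc hd
  linarith

theorem norm_prefixEl_inv_mul (x : Boundary k) {m n : ℕ} (h : m ≤ n) :
    ((prefixEl k x m)⁻¹ * prefixEl k x n).norm = n - m := by
  have h1 : pre x n = pre x m ++ (pre x n).drop m := by
    conv_lhs => rw [← List.take_append_drop m (pre x n), pre_take x h]
  have h2 : prefixEl k x n = prefixEl k x m * FreeGroup.mk ((pre x n).drop m) := by
    rw [prefixEl_eq x n, h1, mk_append, prefixEl_eq, ← h1]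
  rw [h2, inv_mul_cancel_left, norm_mk_of_isReduced
    ((isReduced_pre x n).infix (List.drop_suffix m _).isInfix), List.length_drop, length_pre]

theorem norm_inv_mul_of_heavy [IsProbabilityMeasure μ] (hb : IsBdryExt k Φ b)
    (hhalf : ∀ a, μ.real (b ⁻¹' LC [a]) ≤ 1 / 2) {p q : List (L k)} {a : L k}
    (hp : Heavy μ b (a :: p)) (hq : Heavy μ b (a :: q)) :
    (((FreeGroup.mk (a :: p))⁻¹ * FreeGroup.mk (a :: q) : F k).norm : ℤ) =
      |((a :: p).length : ℤ) - (a :: q).length| := by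
  have hne : ((b ⁻¹' LC (a :: p)) ∩ (b ⁻¹' LC (a :: q))).Nonempty := by
    by_contra h
    have hd := Set.disjoint_iff_inter_eq_empty.2 (Set.not_nonempty_iff_eq_empty.1 h)
    have h1 := measureReal_union (μ := μ) hd (hb.measurable (measurableSet_LC _))
    have h2 : μ.real (b ⁻¹' LC (a :: p) ∪ b ⁻¹' LC (a :: q)) ≤ μ.real (b ⁻¹' LC [a]) := by
      refine measureReal_mono (Set.union_subset ?_ ?_) <;>
      exact Set.preimage_mono (LC_append_subset [a] _)
    have h3 := hhalf a
    rw [Heavy] at hp hq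
    linarith
  obtain ⟨x, h1, h2⟩ := hne
  rw [Set.mem_preimage, mem_LC_iff_pre] at h1 h2
  generalize (a :: p) = p at *
  generalize (a :: q) = q at *
  rw [← h1, ← h2, ← prefixEl_eq, ← prefixEl_eq, length_pre, length_pre]
  rcases le_total p.length q.length with h | h
  · rw [norm_prefixEl_inv_mul _ h, abs_of_nonpos (by omega)]
    omega
  · rw [← FreeGroup.norm_inv_eq, mul_inv_rev, inv_inv, norm_prefixEl_inv_mul _ h,
      abs_of_nonneg (by omega)]
    omega

open Classical in
/-- The length of the longest heavy prefix. -/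
def heavyLen (μ : Measure (Boundary k)) (b : Boundary k → Boundary k) (l : List (L k)) : ℕ :=
  Nat.findGreatest (fun n => Heavy μ b (l.take n)) l.length

theorem heavyLen_le (l : List (L k)) : heavyLen μ b l ≤ l.length := by
  classical
  exact Nat.findGreatest_le _

theorem heavy_take_heavyLen [IsProbabilityMeasure μ] (l : List (L k)) :
    Heavy μ b (l.take (heavyLen μ b l)) := by
  classical
  exact Nat.findGreatest_spec (P := fun n => Heavy μ b (l.take n)) (Nat.zero_le _) heavy_nil

theorem not_heavy_take {l : List (L k)} {n : ℕ} (h : heavyLen μ b l < n) (h' : n ≤ l.length) :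
    ¬ Heavy μ b (l.take n) := by
  classical
  exact Nat.findGreatest_is_greatest h h'

theorem length_sub_heavyLen_le [IsProbabilityMeasure μ] (hb : IsBdryExt k Φ b)
    (hhalf : ∀ a, μ.real (b ⁻¹' LC [a]) ≤ 1 / 2) (g : F k) :
    ((Φ g).norm : ℝ) - heavyLen μ b (Φ g).toWord ≤ 5 * disp μ Φ b g := by
  rw [disp_eq_sum hb]
  set s := heavyLen μ b (Φ g).toWord with hs
  have hsn : s ≤ (Φ g).norm := heavyLen_le _
  have h1 : ∑ i ∈ Finset.Ico s (Φ g).norm, (1 / 5 : ℝ) ≤ ∑ i ∈ Finset.range (Φ g).norm,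
      (1 - 2 * μ.real (b ⁻¹' LC ((Φ g).toWord.take (i + 1)))) := by
    refine (Finset.sum_le_sum fun i hi => ?_).trans
      (Finset.sum_le_sum_of_subset_of_nonneg (fun i hi => ?_) fun i hi _ => ?_)
    · rw [Finset.mem_Ico] at hi
      have := not_heavy_take (μ := μ) (b := b) (l := (Φ g).toWord) (n := i + 1) (by omega) hi.2
      rw [Heavy, not_le] at this
      linarith
    · exact Finset.mem_range.2 (Finset.mem_Ico.1 hi).2
    · have h2 := real_LC_take_le (μ := μ) (b := b) hhalf (l := (Φ g).toWord.take (i + 1)) ?_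
      · linarith
      · rw [Finset.mem_range] at hi
        refine List.ne_nil_of_length_pos ?_
        rw [List.length_take]
        exact lt_min (by omega) (by rw [FreeGroup.norm] at hi; omega)
  rw [Finset.sum_const, Nat.card_Ico, nsmul_eq_mul, Nat.cast_sub hsn] at h1
  linarith

/-- The signed length of the longest heavy prefix, positive in the direction `a`. -/
def heavyPos (μ : Measure (Boundary k)) (b : Boundary k → Boundary k) (a : Option (L k))
    (l : List (L k)) : ℤ :=
  if l.head? = a then heavyLen μ b l else - heavyLen μ b l

theorem abs_heavyPos_sub [IsProbabilityMeasure μ] (hb : IsBdryExt k Φ b)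
    (hhalf : ∀ a, μ.real (b ⁻¹' LC [a]) ≤ 1 / 2) {a : Option (L k)}
    (ha : (∃ c, Heavy μ b [c]) → ∃ c, a = some c ∧ Heavy μ b [c]) {l m : List (L k)}
    (hl : FreeGroup.IsReduced l) (hm : FreeGroup.IsReduced m) :
    |heavyPos μ b a l - heavyPos μ b a m| =
      ((FreeGroup.mk (l.take (heavyLen μ b l)))⁻¹ *
        FreeGroup.mk (m.take (heavyLen μ b m)) : F k).norm := by
  have hp := heavy_take_heavyLen (μ := μ) (b := b) l
  have hq := heavy_take_heavyLen (μ := μ) (b := b) m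
  have hpl : (l.take (heavyLen μ b l)).length = heavyLen μ b l := by
    rw [List.length_take, min_eq_left (heavyLen_le l)]
  have hql : (m.take (heavyLen μ b m)).length = heavyLen μ b m := by
    rw [List.length_take, min_eq_left (heavyLen_le m)]
  have hpr := isReduced_take hl (heavyLen μ b l)
  have hqr := isReduced_take hm (heavyLen μ b m)
  have hph : ∀ c p, l.take (heavyLen μ b l) = c :: p → l.head? = some c := by
    intro c p h
    rw [← List.take_append_drop (heavyLen μ b l) l, h]; rfl
  have hqh : ∀ c p, m.take (heavyLen μ b m) = c :: p → m.head? = some c := by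
    intro c p h
    rw [← List.take_append_drop (heavyLen μ b m) m, h]; rfl
  rw [heavyPos, heavyPos]
  generalize heavyLen μ b l = s at *
  generalize heavyLen μ b m = t at *
  generalize l.take s = p at *
  generalize m.take t = q at *
  have hdiv := norm_inv_mul_of_diverge hpr hqr
  rcases p with _ | ⟨c, p⟩
  · rw [hdiv (by simp)]
    simp only [List.length_nil] at hpl
    split_ifs <;> rcases abs_cases ((s : ℤ) - t) with h | h <;> grind
  rcases q with _ | ⟨d, q⟩
  · rw [hdiv (by simp)]
    simp only [List.length_nil] at hql
    grind
  rw [hph c p rfl, hqh d q rfl]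
  by_cases hcd : c = d
  · subst hcd
    rw [norm_inv_mul_of_heavy hb hhalf hp hq, hpl, hql]
    split_ifs
    · rfl
    · rw [← abs_neg]; congr 1; ring
  · rw [hdiv (by simpa using fun h : d = c => hcd h.symm), hpl, hql]
    obtain ⟨e, he, heh⟩ := ha ⟨c, hp.head (by simp)⟩
    subst he
    by_cases hce : c = e
    · subst hce
      simp [show d ≠ c from fun h => hcd h.symm]
      grind
    · by_cases hde : d = e
      · subst hde
        simp [hce]
        grind
      · exact (not_three_heavy hb (hp.head (a := c) (by simp)) (hq.head (a := d) (by simp)) heh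
          hcd hce hde).elim

/-- Elements of displacement at most `D` are coarsely isometric to points of a line. -/
theorem exists_line_coordinate [IsProbabilityMeasure μ] (hb : IsBdryExt k Φ b)
    (hhalf : ∀ a, μ.real (b ⁻¹' LC [a]) ≤ 1 / 2) {D : ℝ} {M : ℕ} (hM : 5 * D ≤ M) :
    ∃ t : F k → ℤ, t 1 = 0 ∧ ∀ g h, disp μ Φ b g ≤ D → disp μ Φ b h ≤ D →
      |(|t g - t h|) - (Φ (g⁻¹ * h)).norm| ≤ 2 * M := by
  obtain ⟨a, ha⟩ : ∃ a : Option (L k),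
      (∃ c, Heavy μ b [c]) → ∃ c, a = some c ∧ Heavy μ b [c] := by
    by_cases h : ∃ c, Heavy μ b [c]
    · obtain ⟨c, hc⟩ := h
      exact ⟨some c, fun _ => ⟨c, rfl, hc⟩⟩
    · exact ⟨none, fun h' => (h h').elim⟩
  refine ⟨fun g => heavyPos μ b a (Φ g).toWord, ?_, fun g h hg hh => ?_⟩
  · have : heavyLen μ b ([] : List (L k)) = 0 := Nat.le_zero.1 (heavyLen_le [])
    simp [heavyPos, this]
  have hdrop : ∀ g, disp μ Φ b g ≤ D →
      (FreeGroup.mk ((Φ g).toWord.drop (heavyLen μ b (Φ g).toWord)) : F k).norm ≤ M := by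
    intro g hg
    refine FreeGroup.norm_mk_le.trans ?_
    rw [List.length_drop]
    have h1 := length_sub_heavyLen_le hb hhalf g
    have h2 : ((Φ g).norm : ℝ) ≤ M + heavyLen μ b (Φ g).toWord := by linarith
    have h3 : (Φ g).norm ≤ M + heavyLen μ b (Φ g).toWord := by exact_mod_cast h2
    rw [FreeGroup.norm] at h3
    omega
  have hsplit : ∀ g, Φ g = FreeGroup.mk ((Φ g).toWord.take (heavyLen μ b (Φ g).toWord)) *
      FreeGroup.mk ((Φ g).toWord.drop (heavyLen μ b (Φ g).toWord)) := fun g => by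
    rw [← mk_append, List.take_append_drop, FreeGroup.mk_toWord]
  rw [abs_heavyPos_sub hb hhalf ha FreeGroup.isReduced_toWord FreeGroup.isReduced_toWord]
  have hg' := hdrop g hg
  have hh' := hdrop h hh
  have hgs := hsplit g
  have hhs := hsplit h
  set p := (FreeGroup.mk ((Φ g).toWord.take (heavyLen μ b (Φ g).toWord)) : F k)
  set p' := (FreeGroup.mk ((Φ g).toWord.drop (heavyLen μ b (Φ g).toWord)) : F k)
  set q := (FreeGroup.mk ((Φ h).toWord.take (heavyLen μ b (Φ h).toWord)) : F k)
  set q' := (FreeGroup.mk ((Φ h).toWord.drop (heavyLen μ b (Φ h).toWord)) : F k)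
  have e1 : Φ (g⁻¹ * h) = p'⁻¹ * (p⁻¹ * q) * q' := by
    rw [map_mul, map_inv, hgs, hhs]; group
  have e2 : p⁻¹ * q = p' * Φ (g⁻¹ * h) * q'⁻¹ := by rw [e1]; group
  have n1 : (Φ (g⁻¹ * h)).norm ≤ p'.norm + (p⁻¹ * q).norm + q'.norm := by
    rw [e1, ← FreeGroup.norm_inv_eq (x := p')]
    exact (FreeGroup.norm_mul_le _ _).trans (Nat.add_le_add_right (FreeGroup.norm_mul_le _ _) _)
  have n2 : (p⁻¹ * q).norm ≤ p'.norm + (Φ (g⁻¹ * h)).norm + q'.norm := by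
    rw [e2, ← FreeGroup.norm_inv_eq (x := q')]
    exact (FreeGroup.norm_mul_le _ _).trans (Nat.add_le_add_right (FreeGroup.norm_mul_le _ _) _)
  rw [abs_le]
  omega

end Line

/-! ### Bounding the images of generators -/

section Generators

variable {Φ : F k ≃* F k} {b : Boundary k → Boundary k} {μ : Measure (Boundary k)}

/-- `t` is, up to an error `E`, an isometric coordinate on the `Φ`-image of the ball of
radius `6`. -/
structure IsLineCoordinate (Φ : F k ≃* F k) (t : F k → ℤ) (E : ℕ) : Prop where
  one : t 1 = 0
  dist : ∀ g h : F k, g.norm ≤ 6 → h.norm ≤ 6 → |(|t g - t h|) - (Φ (g⁻¹ * h)).norm| ≤ E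

namespace IsLineCoordinate

variable {t : F k → ℤ} {E : ℕ}

theorem abs_sub_norm_le (ht : IsLineCoordinate Φ t E) {g : F k} (hg : g.norm ≤ 6) :
    |(|t g|) - (Φ g).norm| ≤ E := by
  have := ht.dist 1 g (by simp) hg
  simpa [ht.one] using this

theorem sq_le (ht : IsLineCoordinate Φ t E) {u : F k} (hu : u.norm ≤ 6) (hu2 : (u ^ 2).norm ≤ 6) :
    |t (u ^ 2) - 2 * t u| ≤ 10 * E := by
  have h1 := ht.abs_sub_norm_le hu
  have h2 := ht.abs_sub_norm_le hu2
  have h3 := ht.dist u (u ^ 2) hu hu2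
  have h4 := norm_le_norm_sq (Φ u)
  rw [show u⁻¹ * u ^ 2 = u by group] at h3
  rw [← map_pow] at h4
  rw [abs_le] at h1 h2 h3 ⊢
  rcases abs_cases (t u) with h5 | h5 <;> rcases abs_cases (t (u ^ 2)) with h6 | h6 <;>
  rcases abs_cases (t u - t (u ^ 2)) with h7 | h7 <;> omega

theorem mul_le (ht : IsLineCoordinate Φ t E) {u v : F k} (hu : u.norm ≤ 6) (hv : v.norm ≤ 6)
    (hu2 : (u ^ 2).norm ≤ 6) (huv : (u * v).norm ≤ 6) (hfu : 8 * E < (Φ u).norm)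
    (hfv : 8 * E < (Φ v).norm) : |t (u * v) - (t u + t v)| ≤ 2 * E := by
  have h1 := ht.abs_sub_norm_le hu
  have h2 := ht.abs_sub_norm_le hv
  have h3 := ht.dist u (u * v) hu huv
  have h4 := ht.dist (u ^ 2) (u * v) hu2 huv
  have h5 := ht.dist u v hu hv
  have h6 := ht.sq_le hu hu2
  rw [inv_mul_cancel_left] at h3
  rw [show (u ^ 2)⁻¹ * (u * v) = u⁻¹ * v by group] at h4
  rw [abs_le] at h1 h2 h3 h4 h5 h6 ⊢
  rcases abs_cases (t u) with h7 | h7 <;> rcases abs_cases (t v) with h8 | h8 <;>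
  rcases abs_cases (t u - t (u * v)) with h9 | h9 <;>
  rcases abs_cases (t (u ^ 2) - t (u * v)) with h10 | h10 <;>
  rcases abs_cases (t u - t v) with h11 | h11 <;> omega

theorem norm_commutator_le (ht : IsLineCoordinate Φ t E) {u v : F k} (hu : u.norm ≤ 3)
    (hv : v.norm ≤ 3) (hfu : 8 * E < (Φ u).norm) (hfv : 8 * E < (Φ v).norm) :
    (Φ (v⁻¹ * u⁻¹ * v * u)).norm ≤ 5 * E := by
  have h6 : ∀ {x y : F k}, x.norm ≤ 3 → y.norm ≤ 3 → (x * y).norm ≤ 6 := fun hx hy =>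
    (FreeGroup.norm_mul_le _ _).trans (by omega)
  have h1 := ht.mul_le (by omega) (by omega) (by rw [sq]; exact h6 hu hu) (h6 hu hv) hfu hfv
  have h2 := ht.mul_le (by omega) (by omega) (by rw [sq]; exact h6 hv hv) (h6 hv hu) hfv hfu
  have h3 := ht.dist (u * v) (v * u) (h6 hu hv) (h6 hv hu)
  rw [show (u * v)⁻¹ * (v * u) = v⁻¹ * u⁻¹ * v * u by group] at h3
  rw [abs_le] at h1 h2 h3
  rcases abs_cases (t (u * v) - t (v * u)) with h4 | h4 <;> omega

theorem norm_of_le (ht : IsLineCoordinate Φ t E) (hk : 2 ≤ k) (i : Fin k) :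
    (Φ (FreeGroup.of i)).norm ≤ 25 * E := by
  by_contra! hlt
  have : Nontrivial (Fin k) := Fin.nontrivial_iff_two_le.2 hk
  obtain ⟨j, hj⟩ := exists_ne i
  set a : F k := FreeGroup.of i with ha
  set v : F k := FreeGroup.of j * a * (FreeGroup.of j)⁻¹ with hv
  have hna : a.norm = 1 := FreeGroup.norm_of i
  have hnv : v.norm ≤ 3 := by
    refine (FreeGroup.norm_mul_le _ _).trans ?_
    have := FreeGroup.norm_mul_le (FreeGroup.of j) a
    rw [FreeGroup.norm_inv_eq, FreeGroup.norm_of]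
    rw [FreeGroup.norm_of] at this
    omega
  have ha2 : (a ^ 2).norm ≤ 6 := by
    rw [sq]; exact (FreeGroup.norm_mul_le _ _).trans (by omega)
  have hfv : 8 * E < (Φ v).norm := by
    have h1 := norm_sq_le (Φ a) (Φ (FreeGroup.of j))
    rw [← map_inv, ← map_mul, ← map_mul, ← hv, ← map_pow] at h1
    have h2 := ht.sq_le (by omega) ha2
    have h3 := ht.abs_sub_norm_le (g := a) (by omega)
    have h4 := ht.abs_sub_norm_le ha2
    rw [abs_le] at h2 h3 h4
    rcases abs_cases (t a) with h5 | h5 <;> rcases abs_cases (t (a ^ 2)) with h6 | h6 <;> omega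
  have hfa : 8 * E < (Φ a).norm := by omega
  have hfa' : 8 * E < (Φ a⁻¹).norm := by rwa [map_inv, FreeGroup.norm_inv_eq]
  have hfv' : 8 * E < (Φ v⁻¹).norm := by rwa [map_inv, FreeGroup.norm_inv_eq]
  have hna' : a⁻¹.norm ≤ 3 := by rw [FreeGroup.norm_inv_eq]; omega
  have hnv' : v⁻¹.norm ≤ 3 := by rwa [FreeGroup.norm_inv_eq]
  have c1 := ht.norm_commutator_le hnv' hna' hfv' hfa'
  have c2 := ht.norm_commutator_le hnv hna' hfv hfa'
  have c3 := ht.norm_commutator_le (hna.le.trans (by norm_num)) hnv' hfa hfv'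
  have c4 := ht.norm_commutator_le (hna.le.trans (by norm_num)) hnv hfa hfv
  rw [inv_inv, inv_inv] at c1
  rw [inv_inv] at c2 c3
  refine commutators_not_commute hj.symm ha hv (Φ.injective ?_)
  rw [map_mul Φ (a * v * a⁻¹ * v⁻¹), map_mul Φ (a * v⁻¹ * a⁻¹ * v)]
  refine mul_comm_of_norm_le (x := Φ a) (N := 5 * E) (by omega) c1 ?_ c2 ?_
  · rw [← map_inv, ← map_mul, ← map_mul]
    convert c3 using 3
    group
  · rw [← map_inv, ← map_mul, ← map_mul]
    convert c4 using 3
    group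

end IsLineCoordinate

/-- A bound for the lengths of the images of the generators under a centered automorphism. -/
theorem exists_norm_of_le {η : Measure (Boundary k × Boundary k)} (hμ : IsUniform μ)
    (hη : IsUniformCurrent μ η) (R : ℝ) :
    ∃ N : ℕ, ∀ (Φ : F k ≃* F k) (b : Boundary k → Boundary k), IsBdryExt k Φ b →
      (∀ a, μ.real (b ⁻¹' LC [a]) ≤ 1 / 2) → autLen k η b ≠ ⊤ → (autLen k η b).toReal ≤ R →
      ∀ i, (Φ (FreeGroup.of i)).norm ≤ N := by
  have := hμ.prob
  set D := growthConst k 6 * ((2 * k - 2) * R) with hD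
  obtain ⟨M, hM⟩ := exists_nat_ge (5 * D)
  refine ⟨25 * (2 * M), fun Φ b hb hhalf hfin hR => ?_⟩
  have hdisp : ∀ g : F k, g.norm ≤ 6 → disp μ Φ b g ≤ D := by
    intro g hg
    refine (disp_le hμ hb hhalf hg).trans (mul_le_mul_of_nonneg_left ?_ (growthConst_nonneg 6))
    rw [sum_disp_el hμ hb]
    have h2 : (2 : ℝ) ≤ k := by exact_mod_cast hμ.two_le
    exact mul_le_mul_of_nonneg_left ((integral_stepGain_le_autLen hμ hη hb hfin).trans hR)
      (by linarith)
  obtain ⟨t, h1, h2⟩ := exists_line_coordinate hb hhalf hM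
  have ht : IsLineCoordinate Φ t (2 * M) :=
    ⟨h1, fun g h hg hh => by exact_mod_cast h2 g h (hdisp g hg) (hdisp h hh)⟩
  exact ht.norm_of_le hμ.two_le

end Generators

/-! ### Discreteness of the spectrum -/

section Spectrum

theorem finite_norm_le (N : ℕ) : {g : F k | g.norm ≤ N}.Finite :=
  (List.finite_length_le (L k) N).preimage FreeGroup.toWord_injective.injOn

theorem finite_mulAut_norm_le (N : ℕ) :
    {Ψ : MulAut (F k) | ∀ i, (Ψ (FreeGroup.of i)).norm ≤ N}.Finite := by
  refine Set.Finite.of_finite_image (f := fun Ψ i => Ψ (FreeGroup.of i))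
    ((Set.Finite.pi' fun _ : Fin k => finite_norm_le N).subset ?_) fun Ψ _ Ψ' _ h => ?_
  · rintro _ ⟨Ψ, hΨ, rfl⟩
    exact hΨ
  · refine MulEquiv.toMonoidHom_injective (FreeGroup.ext_hom _ _ fun i => ?_)
    exact congrFun h i

theorem isUniformCurrent_of_isCurrent {μ : Measure (Boundary k)}
    {η : Measure (Boundary k × Boundary k)} (h : IsCurrent k η)
    (h' : ∀ x y : F k, η (Cyl2 k x y) = μ (Cyl k (x⁻¹ * y))) : IsUniformCurrent μ η := by
  refine ⟨h.2.1, fun w => ?_⟩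
  have h1 := h' 1 w
  have h2 : actPair k 1 = id := by ext p <;> simp [actPair]
  rwa [Cyl2, h2, Set.image_id, inv_one, one_mul] at h1

theorem finite_autLen_le {μ : Measure (Boundary k)} {η : Measure (Boundary k × Boundary k)}
    (hμ : IsUniform μ) (hη : IsUniformCurrent μ η) {bd : MulAut (F k) → Boundary k → Boundary k}
    (hbd : ∀ Φ : MulAut (F k), IsBdryExt k Φ (bd Φ)) (R : ℝ) :
    {s : ℝ | s ≤ R ∧ ∃ Φ : MulAut (F k), (autLen k η (bd Φ)).toReal = s}.Finite := by
  obtain ⟨N, hN⟩ := exists_norm_of_le hμ hη R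
  refine (((finite_mulAut_norm_le N).image fun Ψ => (autLen k η (bd Ψ)).toReal).insert 0).subset ?_
  rintro _ ⟨hs, Φ, rfl⟩
  by_cases hfin : autLen k η (bd Φ) = ⊤
  · rw [hfin]; exact Or.inl rfl
  obtain ⟨p, hp⟩ := exists_median hμ (hbd Φ)
  have hconj : bd (MulAut.conj p * Φ) = fun x => act k p (bd Φ x) := by
    ext1 x
    exact (hbd Φ).conj (hbd _) p (fun g => rfl) x
  have hlen : autLen k η (bd (MulAut.conj p * Φ)) = autLen k η (bd Φ) := by
    rw [hconj, autLen_comp_act hη (hbd Φ)]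
  refine Or.inr ⟨MulAut.conj p * Φ, hN _ _ (hbd _) ?_ ?_ ?_, ?_⟩
  · rwa [hconj]
  · rwa [hlen]
  · rwa [hlen]
  · exact congrArg ENNReal.toReal hlen

theorem exists_nhds_inter_subsingleton {T : Set ℝ} (h : ∀ R, {s | s ≤ R ∧ s ∈ T}.Finite) (r : ℝ) :
    ∃ U ∈ 𝓝 r, (U ∩ T).Subsingleton := by
  refine ⟨Set.Iic (r + 1) ∩ ({s | s ≤ r + 1 ∧ s ∈ T} \ {r})ᶜ, inter_mem (Iic_mem_nhds (by simp))
    (((h _).subset Set.sdiff_subset).isClosed.isOpen_compl.mem_nhds (by simp)), ?_⟩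
  have key : ∀ s ∈ Set.Iic (r + 1) ∩ ({s | s ≤ r + 1 ∧ s ∈ T} \ {r})ᶜ ∩ T, s = r := by
    rintro s ⟨⟨h1, h2⟩, h3⟩
    by_contra h4
    exact h2 ⟨⟨h1, h3⟩, h4⟩
  exact fun s hs s' hs' => (key s hs).trans (key s' hs').symm

end Spectrum

end Proof

theorem spectrum_discrete (k : ℕ) (hk : 2 ≤ k)
    (μA : Measure (Boundary k)) [IsProbabilityMeasure μA]
    (hμA : ∀ v : F k, v ≠ 1 →
      μA (Cyl k v) = ((2 * k : ℝ≥0∞) * (2 * k - 1) ^ (wordLength k v - 1))⁻¹)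
    (ηA : Measure (Boundary k × Boundary k)) (hηA : IsCurrent k ηA)
    (hηA' : ∀ x y : F k, ηA (Cyl2 k x y) = μA (Cyl k (x⁻¹ * y)))
    (bd : MulAut (F k) → Boundary k → Boundary k)
    (hbd : ∀ Φ : MulAut (F k), IsBdryExt k Φ (bd Φ)) :
    ∀ r : ℝ, ∃ U ∈ 𝓝 r,
      (U ∩ { t : ℝ | ∃ Φ : MulAut (F k), (autLen k ηA (bd Φ)).toReal = t }).Subsingleton :=
  exists_nhds_inter_subsingleton fun R =>
    finite_autLen_le (.of_cyl hk hμA) (isUniformCurrent_of_isCurrent hηA hηA') hbd R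

end

end FGC
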